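/- arXiv:1201.2035 — 4 statements merged into one kernel-verified Lean document; each statement's English description precedes it below -/
import Mathlib

section
/- Suppose f₁, f₂ are C¹ on ℝ², f_an is an anhysteresis function, Λ is an intersecting function, and Assumption (A) holds for all (σ,ξ) ∈ ℝ². Let u be C¹, y := Φ(u,y₀), and fix t and γ > 0 such that u̇ > 0 on [t, t+γ] and y(t) < f_an(u(t)); set u* := Λ(y(t),u(t)), so u* > u(t). For ε ≥ 0 define ω_ε(τ) := ω_Φ(τ, y(t+ε), u(t+ε)). Then for every sufficiently small ε ∈ (0,γ] with u(t+ε) ≤ u*, one has ω_ε(τ) = ω₀(τ) for all τ ∈ [u(t+ε), u*]; hence lim_{ε↘0⁺} (ω_ε(τ) − ω₀(τ))/ε = 0 for every τ ∈ (u(t), u*]. -/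
open MeasureTheory Set Filter intervalIntegral

noncomputable section

/-- `u : [0,∞) → ℝ` is absolutely continuous with a.e. derivative `u'`:
`u'` is locally integrable on `[0,∞)` and `u` is recovered from `u'` by integration. -/
def IsAbsCont (u u' : ℝ → ℝ) : Prop :=
  MeasureTheory.LocallyIntegrableOn u' (Set.Ici 0) ∧
    ∀ t : ℝ, 0 ≤ t → u t = u 0 + ∫ s in (0:ℝ)..t, u' s

/-- `y` is the output `Φ(u, y₀)` of the Duhem operator with data `f₁, f₂`, input `u`
(with a.e. derivative `u'`) and initial value `y₀`: the (absolutely continuous)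
solution of `ẏ = f₁(y,u)·max{0,u̇} + f₂(y,u)·min{0,u̇}`, `y(0) = y₀`,
written in integrated form. -/
def IsDuhemSol (f₁ f₂ : ℝ → ℝ → ℝ) (u u' y : ℝ → ℝ) (y₀ : ℝ) : Prop :=
  y 0 = y₀ ∧
    ∀ t : ℝ, 0 ≤ t →
      y t = y₀ + ∫ s in (0:ℝ)..t,
        (f₁ (y s) (u s) * max 0 (u' s) + f₂ (y s) (u s) * min 0 (u' s))

/-- `F := (f₁ - f₂)/2`. -/
def Fd (f₁ f₂ : ℝ → ℝ → ℝ) (σ ξ : ℝ) : ℝ := (f₁ σ ξ - f₂ σ ξ) / 2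

/-- `fan` is an anhysteresis function for `f₁, f₂`: `F(σ,ξ) = 0 ↔ σ = fan ξ`. -/
def IsAnhysteresis (f₁ f₂ : ℝ → ℝ → ℝ) (fan : ℝ → ℝ) : Prop :=
  ∀ σ ξ : ℝ, Fd f₁ f₂ σ ξ = 0 ↔ σ = fan ξ

/-- `ω` is the traversing function of the Duhem operator: `ω (·) σ ξ` passes through
`(σ,ξ)` and solves `x' = f₁(x,τ)` to the right of `ξ` and `x' = f₂(x,τ)` to the left. -/
def IsTraversing (f₁ f₂ : ℝ → ℝ → ℝ) (ω : ℝ → ℝ → ℝ → ℝ) : Prop :=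
  ∀ σ ξ : ℝ,
    ω ξ σ ξ = σ ∧
    (∀ τ : ℝ, ξ ≤ τ →
      HasDerivWithinAt (fun s => ω s σ ξ) (f₁ (ω τ σ ξ) τ) (Set.Ici ξ) τ) ∧
    (∀ τ : ℝ, τ ≤ ξ →
      HasDerivWithinAt (fun s => ω s σ ξ) (f₂ (ω τ σ ξ) τ) (Set.Iic ξ) τ)

/-- `Lam` is an intersecting function for the anhysteresis function `fan` and the
traversing function `ω`. -/
def IsIntersecting (fan : ℝ → ℝ) (ω : ℝ → ℝ → ℝ → ℝ) (Lam : ℝ → ℝ → ℝ) : Prop :=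
  (∀ σ ξ : ℝ, ω (Lam σ ξ) σ ξ = fan (Lam σ ξ)) ∧
  (∀ σ ξ : ℝ, (fan ξ ≤ σ → Lam σ ξ ≤ ξ) ∧ (σ < fan ξ → ξ < Lam σ ξ))

/-- The storage function
`H_cw(σ,ξ) = ∫₀^{Λ(σ,ξ)} fan(τ) dτ − ∫_ξ^{Λ(σ,ξ)} ω(τ,σ,ξ) dτ`. -/
def Hcw (fan : ℝ → ℝ) (ω : ℝ → ℝ → ℝ → ℝ) (Lam : ℝ → ℝ → ℝ) (σ ξ : ℝ) : ℝ :=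
  (∫ τ in (0:ℝ)..(Lam σ ξ), fan τ) - ∫ τ in ξ..(Lam σ ξ), ω τ σ ξ

/-- Assumption (A): `F(σ,ξ) ≥ 0` whenever `σ ≤ fan ξ`, and `F(σ,ξ) < 0` otherwise. -/
def AssumptionA (f₁ f₂ : ℝ → ℝ → ℝ) (fan : ℝ → ℝ) : Prop :=
  ∀ σ ξ : ℝ, (σ ≤ fan ξ → 0 ≤ Fd f₁ f₂ σ ξ) ∧ (fan ξ < σ → Fd f₁ f₂ σ ξ < 0)

/-- The input-output pair `(u, y)` (with `u̇ = u'` a.e.) is clockwise: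
`liminf_{T→∞} ∫₀^T y(t) u̇(t) dt > -∞`. -/
def Clockwise (u' y : ℝ → ℝ) : Prop :=
  ⊥ < Filter.liminf
      (fun T : ℝ => ((∫ t in (0:ℝ)..T, y t * u' t : ℝ) : EReal)) Filter.atTop

open scoped Topology

/-- A function with right derivative `R` and left derivative `L` at `u x`, composed with a function
`u` differentiable at `x`, has a right derivative at `x`. -/
lemma HasDerivWithinAt.comp_right_of_left_right {X u : ℝ → ℝ} {R L d x : ℝ}
    (hR : HasDerivWithinAt X R (Ici (u x)) (u x)) (hL : HasDerivWithinAt X L (Iic (u x)) (u x))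
    (hu : HasDerivAt u d x) :
    HasDerivWithinAt (fun s => X (u s)) (R * max 0 d + L * min 0 d) (Ici x) x := by
  have hslope : Tendsto (slope u x) (𝓝[>] x) (𝓝 d) := by
    simpa using (hasDerivWithinAt_iff_tendsto_slope' self_notMem_Ioi).1 hu.hasDerivWithinAt
  have hu' := hu.hasDerivWithinAt (s := Ioi x)
  rcases lt_trichotomy d 0 with hd | hd | hd
  · have hev : ∀ᶠ s in 𝓝[>] x, u s ∈ Iic (u x) := by
      filter_upwards [hslope.eventually_lt_const hd, self_mem_nhdsWithin] with s hs hxs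
      rw [slope_def_field, div_lt_iff₀ (sub_pos.2 hxs)] at hs
      simp only [mem_Iic]; linarith
    have := HasDerivWithinAt.comp x (hL.mono (t := Iic (u x)) le_rfl)
      (hu'.mono (inter_subset_left (t := u ⁻¹' Iic (u x)))) (fun s hs => hs.2)
    rw [max_eq_left hd.le, min_eq_right hd.le, mul_zero, zero_add]
    exact (this.mono_of_mem_nhdsWithin (inter_mem self_mem_nhdsWithin hev)).Ici_of_Ioi
  · subst hd
    have hO : (fun z => X z - X (u x)) =O[𝓝 (u x)] fun z => z - u x := by
      rw [← nhdsLE_sup_nhdsGE]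
      exact hL.hasFDerivWithinAt.isBigO_sub.sup hR.hasFDerivWithinAt.isBigO_sub
    have ho : (fun s => u s - u x) =o[𝓝 x] fun s => s - x := by
      simpa using hasDerivAt_iff_isLittleO.1 hu
    have : HasDerivAt (fun s => X (u s)) 0 x := by
      rw [hasDerivAt_iff_isLittleO]
      simpa [Function.comp_def] using (hO.comp_tendsto hu.continuousAt).trans_isLittleO ho
    simpa using this.hasDerivWithinAt
  · have hev : ∀ᶠ s in 𝓝[>] x, u s ∈ Ici (u x) := by
      filter_upwards [hslope.eventually_const_lt hd, self_mem_nhdsWithin] with s hs hxs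
      rw [slope_def_field, lt_div_iff₀ (sub_pos.2 hxs)] at hs
      simp only [mem_Ici]; linarith
    have := HasDerivWithinAt.comp x (hR.mono (t := Ici (u x)) le_rfl)
      (hu'.mono (inter_subset_left (t := u ⁻¹' Ici (u x)))) (fun s hs => hs.2)
    rw [max_eq_right hd.le, min_eq_left hd.le, mul_zero, add_zero]
    exact (this.mono_of_mem_nhdsWithin (inter_mem self_mem_nhdsWithin hev)).Ici_of_Ioi

lemma ContDiff.exists_lipschitz_fst {f : ℝ → ℝ → ℝ} (hf : ContDiff ℝ 1 (Function.uncurry f))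
    (r : ℝ) : ∃ K : NNReal, ∀ ξ, |ξ| ≤ r →
      LipschitzOnWith K (fun σ => f σ ξ) (Metric.closedBall 0 r) := by
  obtain ⟨K, hK⟩ := hf.contDiffOn.exists_lipschitzOnWith one_ne_zero
    (convex_closedBall (0 : ℝ × ℝ) r) (isCompact_closedBall 0 r)
  refine ⟨K, fun ξ hξ => LipschitzOnWith.of_dist_le_mul fun a ha b hb => ?_⟩
  have hmem : ∀ c ∈ Metric.closedBall (0 : ℝ) r, (c, ξ) ∈ Metric.closedBall (0 : ℝ × ℝ) r := by
    intro c hc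
    simpa [Prod.norm_def, hξ] using hc
  simpa [Prod.dist_eq, Function.uncurry] using hK.dist_le_mul _ (hmem a ha) _ (hmem b hb)

lemma ContinuousOn.exists_forall_abs_le {f : ℝ → ℝ} {a b : ℝ} (hf : ContinuousOn f (Icc a b)) :
    ∃ C, ∀ x ∈ Icc a b, |f x| ≤ C :=
  isCompact_Icc.exists_bound_of_continuousOn hf

/-- Uniqueness for the scalar equation `φ' = f(φ, w) k`. -/
lemma eqOn_of_hasDerivWithinAt_mul {f : ℝ → ℝ → ℝ} (hf : ContDiff ℝ 1 (Function.uncurry f))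
    {w k φ ψ : ℝ → ℝ} {a b : ℝ} (hw : ContinuousOn w (Icc a b)) (hk : ContinuousOn k (Icc a b))
    (hφ : ContinuousOn φ (Icc a b))
    (hφ' : ∀ x ∈ Ico a b, HasDerivWithinAt φ (f (φ x) (w x) * k x) (Ici x) x)
    (hψ : ContinuousOn ψ (Icc a b))
    (hψ' : ∀ x ∈ Ico a b, HasDerivWithinAt ψ (f (ψ x) (w x) * k x) (Ici x) x)
    (hab : φ a = ψ a) : EqOn φ ψ (Icc a b) := by
  obtain ⟨A, hA⟩ := hφ.exists_forall_abs_le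
  obtain ⟨B, hB⟩ := hψ.exists_forall_abs_le
  obtain ⟨C, hC⟩ := hw.exists_forall_abs_le
  obtain ⟨D, hD⟩ := hk.exists_forall_abs_le
  set r := max A (max B C)
  obtain ⟨K, hK⟩ := hf.exists_lipschitz_fst r
  refine ODE_solution_unique_of_mem_Icc_right (v := fun x σ => f σ (w x) * k x)
    (s := fun _ => Metric.closedBall 0 r) (K := K * D.toNNReal) ?_ hφ hφ' ?_ hψ hψ' ?_ hab
  · intro x hx
    have hx' := Ico_subset_Icc_self hx
    have hr : |w x| ≤ r := (hC x hx').trans ((le_max_right _ _).trans (le_max_right _ _))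
    refine LipschitzOnWith.of_dist_le_mul fun σ hσ ρ hρ => ?_
    have h := (hK _ hr).dist_le_mul σ hσ ρ hρ
    rw [Real.dist_eq, ← sub_mul, abs_mul, NNReal.coe_mul,
      Real.coe_toNNReal D ((abs_nonneg _).trans (hD x hx')), mul_right_comm]
    exact mul_le_mul h (hD x hx') (abs_nonneg _) (by positivity)
  · intro x hx
    exact mem_closedBall_zero_iff.2 <| (hA x (Ico_subset_Icc_self hx)).trans (le_max_left A (max B C))
  · intro x hx
    exact mem_closedBall_zero_iff.2 <| (hB x (Ico_subset_Icc_self hx)).trans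
      ((le_max_left B C).trans (le_max_right A (max B C)))

/-- `X` solves `X' = f₁(X, τ)` to the right of `ξ` and `X' = f₂(X, τ)` to the left of `ξ`. -/
def IsTraversingCurve (f₁ f₂ : ℝ → ℝ → ℝ) (ξ : ℝ) (X : ℝ → ℝ) : Prop :=
  (∀ τ, ξ ≤ τ → HasDerivWithinAt X (f₁ (X τ) τ) (Ici ξ) τ) ∧
    ∀ τ, τ ≤ ξ → HasDerivWithinAt X (f₂ (X τ) τ) (Iic ξ) τ

namespace IsTraversingCurve

variable {f₁ f₂ : ℝ → ℝ → ℝ} {ξ : ℝ} {X : ℝ → ℝ}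

lemma hasDerivWithinAt_Ici (h : IsTraversingCurve f₁ f₂ ξ X) (τ : ℝ) :
    HasDerivWithinAt X (if ξ ≤ τ then f₁ (X τ) τ else f₂ (X τ) τ) (Ici τ) τ := by
  split_ifs with hτ
  · exact (h.1 τ hτ).mono (Ici_subset_Ici.2 hτ)
  · push Not at hτ
    exact ((h.2 τ hτ.le).hasDerivAt (Iic_mem_nhds hτ)).hasDerivWithinAt

lemma hasDerivWithinAt_Iic (h : IsTraversingCurve f₁ f₂ ξ X) (τ : ℝ) :
    HasDerivWithinAt X (if τ ≤ ξ then f₂ (X τ) τ else f₁ (X τ) τ) (Iic τ) τ := by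
  split_ifs with hτ
  · exact (h.2 τ hτ).mono (Iic_subset_Iic.2 hτ)
  · push Not at hτ
    exact ((h.1 τ hτ.le).hasDerivAt (Ici_mem_nhds hτ)).hasDerivWithinAt

lemma continuous (h : IsTraversingCurve f₁ f₂ ξ X) : Continuous X :=
  continuous_iff_continuousAt.2 fun τ => continuousAt_iff_continuous_left_right.2
    ⟨(h.hasDerivWithinAt_Iic τ).continuousWithinAt, (h.hasDerivWithinAt_Ici τ).continuousWithinAt⟩

/-- If `f₁ ≤ f₂` along `y` wherever `y` is above the traversing curve `X`, then the Duhem output `y`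
cannot cross `X` upwards. -/
lemma le_of_hasDerivWithinAt (hX : IsTraversingCurve f₁ f₂ ξ X)
    (hf₁ : ContDiff ℝ 1 (Function.uncurry f₁)) (hf₂ : ContDiff ℝ 1 (Function.uncurry f₂))
    {u y : ℝ → ℝ} {a b : ℝ} (hu : ContDiff ℝ 1 u) (hy : ContinuousOn y (Icc a b))
    (hy' : ∀ t ∈ Ico a b, HasDerivWithinAt y
      (f₁ (y t) (u t) * max 0 (deriv u t) + f₂ (y t) (u t) * min 0 (deriv u t)) (Ici t) t)
    (ha : y a ≤ X (u a))
    (hle : ∀ t ∈ Ico a b, X (u t) ≤ y t → f₁ (y t) (u t) ≤ f₂ (y t) (u t)) (hab : a ≤ b) :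
    y b ≤ X (u b) := by
  have hcX : Continuous fun t => X (u t) := hX.continuous.comp hu.continuous
  have hcu' : Continuous (deriv u) := hu.continuous_deriv le_rfl
  have hd : ContinuousOn (fun t => y t - X (u t)) (Icc a b) := hy.sub hcX.continuousOn
  by_contra! hb
  have hcpt : IsCompact (Icc a b ∩ (fun t => y t - X (u t)) ⁻¹' Iic 0) :=
    isCompact_Icc.of_isClosed_subset (hd.preimage_isClosed_of_isClosed isClosed_Icc isClosed_Iic)
      inter_subset_left
  obtain ⟨s, ⟨hs, hs0⟩, hsmax⟩ := hcpt.exists_isGreatest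
    ⟨a, left_mem_Icc.2 hab, by simpa using ha⟩
  have hpos : ∀ t ∈ Ioc s b, 0 < y t - X (u t) := by
    intro t ht
    by_contra! h
    exact ht.1.not_ge (hsmax ⟨⟨hs.1.trans ht.1.le, ht.2⟩, h⟩)
  have hsb : s < b := by
    refine lt_of_le_of_ne hs.2 fun h => ?_
    simp only [mem_preimage, mem_Iic, h] at hs0
    linarith
  have hsub : Icc s b ⊆ Icc a b := Icc_subset_Icc_left hs.1
  have hnn : ∀ t ∈ Icc s b, 0 ≤ y t - X (u t) := by
    have : closure (Ioc s b) ⊆ Icc a b ∩ (fun t => y t - X (u t)) ⁻¹' Ici 0 :=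
      closure_minimal (fun t ht => ⟨⟨hs.1.trans ht.1.le, ht.2⟩, (hpos t ht).le⟩)
        (hd.preimage_isClosed_of_isClosed isClosed_Icc isClosed_Ici)
    rw [closure_Ioc hsb.ne] at this
    exact fun t ht => (this ht).2
  obtain ⟨A, hA⟩ := (hy.mono hsub).exists_forall_abs_le
  obtain ⟨B, hB⟩ := (hcX.continuousOn (s := Icc s b)).exists_forall_abs_le
  obtain ⟨C, hC⟩ := (hu.continuous.continuousOn (s := Icc s b)).exists_forall_abs_le
  obtain ⟨D, hD⟩ := (hcu'.continuousOn (s := Icc s b)).exists_forall_abs_le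
  set r := max A (max B C)
  obtain ⟨K₁, hK₁⟩ := hf₁.exists_lipschitz_fst r
  obtain ⟨K₂, hK₂⟩ := hf₂.exists_lipschitz_fst r
  have hder : ∀ t ∈ Ico s b, HasDerivWithinAt (fun t => y t - X (u t)) _ (Ici t) t := fun t ht =>
    (hy' t ⟨hs.1.trans ht.1, ht.2⟩).sub (HasDerivWithinAt.comp_right_of_left_right
      (hX.hasDerivWithinAt_Ici (u t)) (hX.hasDerivWithinAt_Iic (u t))
      (hu.differentiable one_ne_zero t).hasDerivAt)
  have key := le_gronwallBound_of_liminf_deriv_right_le (δ := 0) (K := (K₁ + K₂) * D) (ε := 0)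
    (hd.mono hsub) (fun t ht _ hlt => (hder t ht).liminf_right_slope_le hlt) hs0 ?_
    b (right_mem_Icc.2 hsb.le)
  · rw [gronwallBound_ε0_δ0] at key
    linarith [hpos b (right_mem_Ioc.2 hsb)]
  · intro t ht
    have ht' := Ico_subset_Icc_self ht
    have h0 := hnn t ht'
    have h12 := hle t ⟨hs.1.trans ht.1, ht.2⟩ (by linarith)
    have hyr : y t ∈ Metric.closedBall 0 r := by
      exact mem_closedBall_zero_iff.2 <| (hA t ht').trans (le_max_left A (max B C))
    have hXr : X (u t) ∈ Metric.closedBall 0 r := by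
      exact mem_closedBall_zero_iff.2 <| (hB t ht').trans ((le_max_left B C).trans (le_max_right A (max B C)))
    have hur : |u t| ≤ r := (hC t ht').trans ((le_max_right _ _).trans (le_max_right _ _))
    have h₁ := (hK₁ _ hur).dist_le_mul _ hyr _ hXr
    have h₂ := (hK₂ _ hur).dist_le_mul _ hyr _ hXr
    rw [Real.dist_eq, Real.dist_eq, abs_of_nonneg h0, abs_le] at h₁ h₂
    have hDt := abs_le.1 (hD t ht')
    have hK₁0 := mul_nonneg K₁.2 h0
    have hK₂0 := mul_nonneg K₂.2 h0
    simp only [NNReal.val_eq_coe] at hK₁0 hK₂0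
    rw [add_zero]
    rcases le_total 0 (deriv u t) with hu0 | hu0
    · rw [max_eq_right hu0, min_eq_left hu0, mul_zero, mul_zero, add_zero, add_zero, ← sub_mul]
      calc _ ≤ ((K₁ + K₂) * (y t - X (u t))) * deriv u t := by
            gcongr
            split_ifs <;> linarith
        _ ≤ ((K₁ + K₂) * (y t - X (u t))) * D := by
            gcongr
            exact hDt.2
        _ = _ := by ring
    · rw [max_eq_left hu0, min_eq_right hu0, mul_zero, mul_zero, zero_add, zero_add, ← sub_mul]
      calc _ ≤ (-((K₁ + K₂) * (y t - X (u t)))) * deriv u t := by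
            refine mul_le_mul_of_nonpos_right ?_ hu0
            split_ifs <;> linarith
        _ = ((K₁ + K₂) * (y t - X (u t))) * -deriv u t := by ring
        _ ≤ ((K₁ + K₂) * (y t - X (u t))) * D := by
            gcongr
            linarith
        _ = _ := by ring

end IsTraversingCurve

/-- A Duhem output does not blow up to `+∞` in finite time when all traversing curves are global and
`f₁ ≤ f₂` for large outputs. -/
lemma exists_eventually_le_of_traversing {f₁ f₂ : ℝ → ℝ → ℝ}
    (hf₁ : ContDiff ℝ 1 (Function.uncurry f₁)) (hf₂ : ContDiff ℝ 1 (Function.uncurry f₂))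
    (hex : ∀ σ ξ, ∃ X, X ξ = σ ∧ IsTraversingCurve f₁ f₂ ξ X)
    {u y : ℝ → ℝ} {a B : ℝ} (hu : ContDiff ℝ 1 u) (ha : 0 < a)
    (hB : ∀ᶠ ξ in 𝓝 (u a), ∀ σ, B ≤ σ → f₁ σ ξ ≤ f₂ σ ξ) (hy : ContinuousOn y (Ico 0 a))
    (hy' : ∀ t ∈ Ico 0 a, HasDerivWithinAt y
      (f₁ (y t) (u t) * max 0 (deriv u t) + f₂ (y t) (u t) * min 0 (deriv u t)) (Ici t) t) :
    ∃ C, ∀ᶠ t in 𝓝[<] a, y t ≤ C := by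
  have hcomp : ∀ ξ X, IsTraversingCurve f₁ f₂ ξ X → ∀ s ∈ Ico 0 a, y s ≤ X (u s) →
      (∀ t ∈ Ico s a, X (u t) ≤ y t → f₁ (y t) (u t) ≤ f₂ (y t) (u t)) →
      ∃ C, ∀ᶠ t in 𝓝[<] a, y t ≤ C := by
    intro ξ X hX s hs hys hle
    obtain ⟨C, hC⟩ := ((hX.continuous.comp hu.continuous).continuousOn
      (s := Icc s a)).exists_forall_abs_le
    refine ⟨C, ?_⟩
    filter_upwards [Ico_mem_nhdsLT hs.2] with t ht
    refine le_trans ?_ ((le_abs_self _).trans (hC t ⟨ht.1, ht.2.le⟩))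
    exact hX.le_of_hasDerivWithinAt hf₁ hf₂ hu
      (hy.mono fun x hx => ⟨hs.1.trans hx.1, hx.2.trans_lt ht.2⟩)
      (fun x hx => hy' x ⟨hs.1.trans hx.1, hx.2.trans ht.2⟩) hys
      (fun x hx => hle x ⟨hx.1, hx.2.trans ht.2⟩) ht.1
  have hB' : ∀ᶠ t in 𝓝[<] a, ∀ σ, B ≤ σ → f₁ σ (u t) ≤ f₂ σ (u t) :=
    (hu.continuous.continuousAt.eventually hB).filter_mono nhdsWithin_le_nhds
  have h0a : ∀ᶠ t in 𝓝[<] a, t ∈ Ico 0 a := Ico_mem_nhdsLT ha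
  by_cases hfreq : ∃ᶠ t in 𝓝[<] a, y t < B
  · obtain ⟨X, hXa, hX⟩ := hex (B + 1) (u a)
    have hXB : ∀ᶠ t in 𝓝[<] a, B < X (u t) := by
      refine Eventually.filter_mono nhdsWithin_le_nhds
        ((hX.continuous.comp hu.continuous).continuousAt.eventually_const_lt ?_)
      simp [hXa]
    obtain ⟨l, hl, hlB⟩ := (mem_nhdsLT_iff_exists_Ico_subset).1 (hB'.and hXB)
    obtain ⟨s, ⟨hsy, hs0⟩, hsl⟩ := ((hfreq.and_eventually h0a).and_eventually
      (Ico_mem_nhdsLT hl)).exists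
    refine hcomp _ X hX s hs0 (hsy.le.trans (hlB hsl).2.le) fun t ht htX => ?_
    have := hlB ⟨hsl.1.trans ht.1, ht.2⟩
    exact this.1 _ (this.2.le.trans htX)
  · rw [not_frequently] at hfreq
    obtain ⟨l, hl, hlB⟩ := (mem_nhdsLT_iff_exists_Ico_subset).1 (hB'.and hfreq)
    obtain ⟨s, hs0, hsl⟩ := (h0a.and (Ico_mem_nhdsLT hl)).exists
    obtain ⟨X, hXs, hX⟩ := hex (y s) (u s)
    refine hcomp _ X hX s hs0 hXs.ge fun t ht _ => ?_
    have := hlB ⟨hsl.1.trans ht.1, ht.2⟩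
    exact this.1 _ (not_lt.1 this.2)

lemma IsTraversingCurve.neg {f₁ f₂ : ℝ → ℝ → ℝ} {ξ : ℝ} {X : ℝ → ℝ}
    (h : IsTraversingCurve f₁ f₂ ξ X) :
    IsTraversingCurve (fun σ τ => -f₁ (-σ) τ) (fun σ τ => -f₂ (-σ) τ) ξ (fun τ => -X τ) :=
  ⟨fun τ hτ => by simpa using (h.1 τ hτ).fun_neg, fun τ hτ => by simpa using (h.2 τ hτ).fun_neg⟩

lemma exists_eventually_ge_of_traversing {f₁ f₂ : ℝ → ℝ → ℝ}
    (hf₁ : ContDiff ℝ 1 (Function.uncurry f₁)) (hf₂ : ContDiff ℝ 1 (Function.uncurry f₂))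
    (hex : ∀ σ ξ, ∃ X, X ξ = σ ∧ IsTraversingCurve f₁ f₂ ξ X)
    {u y : ℝ → ℝ} {a B : ℝ} (hu : ContDiff ℝ 1 u) (ha : 0 < a)
    (hB : ∀ᶠ ξ in 𝓝 (u a), ∀ σ, σ ≤ B → f₂ σ ξ ≤ f₁ σ ξ) (hy : ContinuousOn y (Ico 0 a))
    (hy' : ∀ t ∈ Ico 0 a, HasDerivWithinAt y
      (f₁ (y t) (u t) * max 0 (deriv u t) + f₂ (y t) (u t) * min 0 (deriv u t)) (Ici t) t) :
    ∃ C, ∀ᶠ t in 𝓝[<] a, C ≤ y t := by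
  have hneg : ContDiff ℝ 1 fun p : ℝ × ℝ => (-p.1, p.2) := by fun_prop
  obtain ⟨C, hC⟩ := exists_eventually_le_of_traversing (f₁ := fun σ τ => -f₁ (-σ) τ)
    (f₂ := fun σ τ => -f₂ (-σ) τ) (y := fun t => -y t) (B := -B) (hf₁.comp hneg).neg
    (hf₂.comp hneg).neg
    (fun σ ξ => by
      obtain ⟨X, hXξ, hX⟩ := hex (-σ) ξ
      exact ⟨_, by simp [hXξ], hX.neg⟩)
    hu ha
    (hB.mono fun ξ h σ hσ => neg_le_neg (h (-σ) (by linarith))) hy.neg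
    (fun t ht => by
      refine (hy' t ht).fun_neg.congr_deriv ?_
      simp only [neg_neg]
      ring)
  exact ⟨-C, hC.mono fun t ht => by linarith⟩

namespace IsDuhemSol

variable {f₁ f₂ : ℝ → ℝ → ℝ} {u y : ℝ → ℝ} {y₀ : ℝ}

lemma continuousOn_of_intervalIntegrable (hy : IsDuhemSol f₁ f₂ u (deriv u) y y₀) {a : ℝ}
    (hint : ∀ T ∈ Ico 0 a, IntervalIntegrable (fun s => f₁ (y s) (u s) * max 0 (deriv u s) +
      f₂ (y s) (u s) * min 0 (deriv u s)) volume 0 T) : ContinuousOn y (Ico 0 a) := by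
  intro x hx
  obtain ⟨b, hxb, hba⟩ := exists_between hx.2
  have hb : 0 ≤ b := hx.1.trans hxb.le
  have hcont := continuousOn_primitive_interval' (hint b ⟨hb, hba⟩) left_mem_uIcc
  rw [uIcc_of_le hb] at hcont
  refine (((continuousOn_const (c := y₀)).add hcont).congr
    (fun t ht => hy.2 t ht.1 : EqOn y _ _) x ⟨hx.1, hxb.le⟩).mono_of_mem_nhdsWithin ?_
  filter_upwards [self_mem_nhdsWithin, nhdsWithin_le_nhds (Iio_mem_nhds hxb)] with t ht htb
  exact ⟨ht.1, le_of_lt htb⟩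

lemma continuousOn_rhs (hf₁ : ContDiff ℝ 1 (Function.uncurry f₁))
    (hf₂ : ContDiff ℝ 1 (Function.uncurry f₂)) (hu : ContDiff ℝ 1 u) {s : Set ℝ}
    (hy : ContinuousOn y s) :
    ContinuousOn (fun t => f₁ (y t) (u t) * max 0 (deriv u t) +
      f₂ (y t) (u t) * min 0 (deriv u t)) s := by
  have hyu := hy.prodMk hu.continuous.continuousOn
  have hu' := (hu.continuous_deriv le_rfl).continuousOn (s := s)
  exact ((hf₁.continuous.comp_continuousOn hyu).mul (continuousOn_const.sup hu')).add
    ((hf₂.continuous.comp_continuousOn hyu).mul (continuousOn_const.inf hu'))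

lemma hasDerivWithinAt_of_intervalIntegrable (hy : IsDuhemSol f₁ f₂ u (deriv u) y y₀)
    (hf₁ : ContDiff ℝ 1 (Function.uncurry f₁)) (hf₂ : ContDiff ℝ 1 (Function.uncurry f₂))
    (hu : ContDiff ℝ 1 u) {a : ℝ}
    (hint : ∀ T ∈ Ico 0 a, IntervalIntegrable (fun s => f₁ (y s) (u s) * max 0 (deriv u s) +
      f₂ (y s) (u s) * min 0 (deriv u s)) volume 0 T) {t : ℝ} (ht : t ∈ Ico 0 a) :
    HasDerivWithinAt y
      (f₁ (y t) (u t) * max 0 (deriv u t) + f₂ (y t) (u t) * min 0 (deriv u t)) (Ici t) t := by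
  have hg := continuousOn_rhs hf₁ hf₂ hu (hy.continuousOn_of_intervalIntegrable hint)
  have hle : 𝓝[>] t ≤ 𝓝[Ico 0 a] t := by
    refine le_inf inf_le_left (le_principal_iff.2 ?_)
    filter_upwards [self_mem_nhdsWithin, nhdsWithin_le_nhds (Iio_mem_nhds ht.2)] with s hs hsa
    exact ⟨ht.1.trans (le_of_lt hs), hsa⟩
  have hder := integral_hasDerivWithinAt_right (s := Ici t) (t := Ioi t) (hint t ht)
    ((hg.stronglyMeasurableAtFilter_nhdsWithin measurableSet_Ico t).filter_mono hle)
    ((hg t ht).mono_left hle)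
  exact (hder.const_add y₀).congr (fun s hs => hy.2 s (ht.1.trans hs)) (hy.2 t ht.1)

/-- No blow-up: the right-hand side of the Duhem equation is integrable on bounded intervals. -/
lemma intervalIntegrable (hy : IsDuhemSol f₁ f₂ u (deriv u) y y₀)
    (hf₁ : ContDiff ℝ 1 (Function.uncurry f₁)) (hf₂ : ContDiff ℝ 1 (Function.uncurry f₂))
    (hu : ContDiff ℝ 1 u)
    (hex : ∀ σ ξ, ∃ X, X ξ = σ ∧ IsTraversingCurve f₁ f₂ ξ X)
    (habove : ∀ ξ₀, ∃ B, ∀ᶠ ξ in 𝓝 ξ₀, ∀ σ, B ≤ σ → f₁ σ ξ ≤ f₂ σ ξ)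
    (hbelow : ∀ ξ₀, ∃ B, ∀ᶠ ξ in 𝓝 ξ₀, ∀ σ, σ ≤ B → f₂ σ ξ ≤ f₁ σ ξ) {T : ℝ} (hT : 0 ≤ T) :
    IntervalIntegrable (fun s => f₁ (y s) (u s) * max 0 (deriv u s) +
      f₂ (y s) (u s) * min 0 (deriv u s)) volume 0 T := by
  set g := fun s => f₁ (y s) (u s) * max 0 (deriv u s) + f₂ (y s) (u s) * min 0 (deriv u s)
  by_contra hnot
  set S : Set ℝ := {s | 0 ≤ s ∧ IntervalIntegrable g volume 0 s}
  have hdown : ∀ s ∈ S, ∀ r, 0 ≤ r → r ≤ s → r ∈ S := fun s hs r hr hrs =>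
    ⟨hr, hs.2.mono_set (by rw [uIcc_of_le hr, uIcc_of_le hs.1]; exact Icc_subset_Icc_right hrs)⟩
  have h0S : (0 : ℝ) ∈ S := ⟨le_rfl, IntervalIntegrable.refl⟩
  have hST : ∀ s ∈ S, s ≤ T := fun s hs => by
    by_contra! h
    exact hnot (hdown s hs T hT h.le).2
  set a := sSup S
  have hbdd : BddAbove S := ⟨T, hST⟩
  have ha0 : 0 ≤ a := le_csSup hbdd h0S
  have haT : a ≤ T := csSup_le ⟨0, h0S⟩ hST
  have hint : ∀ s ∈ Ico 0 a, IntervalIntegrable g volume 0 s := by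
    intro s hs
    obtain ⟨r, hr, hsr⟩ := exists_lt_of_lt_csSup ⟨0, h0S⟩ hs.2
    exact (hdown r hr s hs.1 hsr.le).2
  have hgM : ∀ C D : ℝ, ∃ M, ∀ s ∈ Icc 0 T, y s ∈ Icc C D → ‖g s‖ ≤ M := by
    intro C D
    have hcont : ContinuousOn (fun p : ℝ × ℝ => f₁ p.1 (u p.2) * max 0 (deriv u p.2) +
        f₂ p.1 (u p.2) * min 0 (deriv u p.2)) (Icc C D ×ˢ Icc 0 T) := by
      have hyu : Continuous fun p : ℝ × ℝ => (p.1, u p.2) :=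
        continuous_fst.prodMk (hu.continuous.comp continuous_snd)
      have hu' := (hu.continuous_deriv le_rfl).comp (continuous_snd (X := ℝ))
      exact (((hf₁.continuous.comp hyu).mul (continuous_const.sup hu')).add
        ((hf₂.continuous.comp hyu).mul (continuous_const.inf hu'))).continuousOn
    obtain ⟨M, hM⟩ := (isCompact_Icc.prod isCompact_Icc).exists_bound_of_continuousOn hcont
    exact ⟨M, fun s hs hys => hM (y s, s) ⟨hys, hs⟩⟩
  have haS : a ∈ S := by
    rcases ha0.eq_or_lt with ha | ha
    · rwa [← ha]
    have hyc := hy.continuousOn_of_intervalIntegrable hint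
    have hyd := fun t ht =>
      hy.hasDerivWithinAt_of_intervalIntegrable hf₁ hf₂ hu hint (t := t) ht
    obtain ⟨B, hB⟩ := habove (u a)
    obtain ⟨B', hB'⟩ := hbelow (u a)
    obtain ⟨D, hD⟩ := exists_eventually_le_of_traversing hf₁ hf₂ hex hu ha hB hyc hyd
    obtain ⟨C, hC⟩ := exists_eventually_ge_of_traversing hf₁ hf₂ hex hu ha hB' hyc hyd
    obtain ⟨M, hM⟩ := hgM C D
    obtain ⟨l, hl, hlCD⟩ := (mem_nhdsLT_iff_exists_Ico_subset).1 (hC.and hD)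
    obtain ⟨s, ⟨hs0, hsa⟩, hls, -⟩ :=
      (Filter.Eventually.and (Ico_mem_nhdsLT ha) (Ico_mem_nhdsLT hl)).exists
    refine ⟨ha0, (hint s ⟨hs0, hsa⟩).trans ?_⟩
    rw [intervalIntegrable_iff_integrableOn_Ico_of_le hsa.le]
    refine IntegrableOn.of_bound measure_Ico_lt_top
      (((continuousOn_rhs hf₁ hf₂ hu hyc).mono (Ico_subset_Ico_left hs0)).aestronglyMeasurable
        measurableSet_Ico) M ?_
    filter_upwards [ae_restrict_mem measurableSet_Ico] with r hr
    exact hM r ⟨hs0.trans hr.1, hr.2.le.trans haT⟩ (hlCD ⟨hls.trans hr.1, hr.2⟩)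
  refine hnot (haS.2.trans ?_)
  have hy₀ : ∀ s ∈ Ioc a T, y s = y₀ := by
    intro s hs
    have hs0 := ha0.trans hs.1.le
    rw [hy.2 s hs0, integral_undef fun h => hs.1.not_ge (le_csSup hbdd ⟨hs0, h⟩), add_zero]
  rw [intervalIntegrable_iff_integrableOn_Ioc_of_le haT]
  obtain ⟨M, hM⟩ := hgM y₀ y₀
  refine IntegrableOn.of_bound measure_Ioc_lt_top ((continuousOn_rhs hf₁ hf₂ hu
    (continuousOn_const.congr hy₀)).aestronglyMeasurable measurableSet_Ioc) M ?_
  filter_upwards [ae_restrict_mem measurableSet_Ioc] with r hr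
  exact hM r ⟨ha0.trans hr.1.le, hr.2⟩ (by simp [hy₀ r hr])

end IsDuhemSol

/-- The sign condition on `F` forces `fan` to be locally bounded above, whence `f₁ ≤ f₂` for large
outputs. -/
lemma AssumptionA.exists_eventually_le {f₁ f₂ : ℝ → ℝ → ℝ} {fan : ℝ → ℝ}
    (hA : AssumptionA f₁ f₂ fan) (hf₁ : Continuous (Function.uncurry f₁))
    (hf₂ : Continuous (Function.uncurry f₂)) (ξ₀ : ℝ) :
    ∃ B, ∀ᶠ ξ in 𝓝 ξ₀, ∀ σ, B ≤ σ → f₁ σ ξ ≤ f₂ σ ξ := by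
  refine ⟨fan ξ₀ + 1, ?_⟩
  have hF : Continuous fun ξ => Fd f₁ f₂ (fan ξ₀ + 1) ξ :=
    ((hf₁.comp (by fun_prop : Continuous fun ξ : ℝ => (fan ξ₀ + 1, ξ))).sub
      (hf₂.comp (by fun_prop : Continuous fun ξ : ℝ => (fan ξ₀ + 1, ξ)))).div_const 2
  filter_upwards [hF.continuousAt.eventually_lt_const ((hA _ ξ₀).2 (lt_add_one _))] with ξ hξ σ hσ
  have hfan : fan ξ < fan ξ₀ + 1 := by
    by_contra! h
    exact hξ.not_ge ((hA _ ξ).1 h)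
  have := (hA σ ξ).2 (hfan.trans_le hσ)
  rw [Fd] at this
  linarith

lemma AssumptionA.exists_eventually_ge {f₁ f₂ : ℝ → ℝ → ℝ} {fan : ℝ → ℝ}
    (hA : AssumptionA f₁ f₂ fan) (han : IsAnhysteresis f₁ f₂ fan)
    (hf₁ : Continuous (Function.uncurry f₁)) (hf₂ : Continuous (Function.uncurry f₂)) (ξ₀ : ℝ) :
    ∃ B, ∀ᶠ ξ in 𝓝 ξ₀, ∀ σ, σ ≤ B → f₂ σ ξ ≤ f₁ σ ξ := by
  refine ⟨fan ξ₀ - 1, ?_⟩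
  have hF : Continuous fun ξ => Fd f₁ f₂ (fan ξ₀ - 1) ξ :=
    ((hf₁.comp (by fun_prop : Continuous fun ξ : ℝ => (fan ξ₀ - 1, ξ))).sub
      (hf₂.comp (by fun_prop : Continuous fun ξ : ℝ => (fan ξ₀ - 1, ξ)))).div_const 2
  have hpos : 0 < Fd f₁ f₂ (fan ξ₀ - 1) ξ₀ :=
    lt_of_le_of_ne ((hA _ ξ₀).1 (sub_one_lt _).le) fun h =>
      (sub_one_lt (fan ξ₀)).ne ((han _ _).1 h.symm)
  filter_upwards [hF.continuousAt.eventually_const_lt hpos] with ξ hξ σ hσ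
  have hfan : fan ξ₀ - 1 ≤ fan ξ := by
    by_contra! h
    exact hξ.not_gt ((hA _ ξ).2 h)
  have := (hA σ ξ).1 (hσ.trans hfan)
  rw [Fd] at this
  linarith

/-- the case `u̇ > 0` on `[t,t+γ]`, `y(t) < fan(u(t))` in the proof of
Theorem 1: with `u* = Λ(y(t),u(t)) > u(t)` and `ω_ε(τ) = ω(τ, y(t+ε), u(t+ε))`, for all
sufficiently small `ε ∈ (0,γ]` with `u(t+ε) ≤ u*` one has `ω_ε = ω₀` on `[u(t+ε), u*]`;
hence `lim_{ε↘0} (ω_ε(τ) − ω₀(τ))/ε = 0` for every `τ ∈ (u(t), u*]`. -/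
theorem duhem_case_increasing_below
    (f₁ f₂ : ℝ → ℝ → ℝ) (fan : ℝ → ℝ) (ω : ℝ → ℝ → ℝ → ℝ) (Lam : ℝ → ℝ → ℝ)
    (hf₁ : ContDiff ℝ 1 (Function.uncurry f₁))
    (hf₂ : ContDiff ℝ 1 (Function.uncurry f₂))
    (han : IsAnhysteresis f₁ f₂ fan)
    (hω : IsTraversing f₁ f₂ ω)
    (hLam : IsIntersecting fan ω Lam)
    (hA : AssumptionA f₁ f₂ fan)
    (u y : ℝ → ℝ) (y₀ t γ : ℝ)
    (hu : ContDiff ℝ 1 u)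
    (hy : IsDuhemSol f₁ f₂ u (deriv u) y y₀)
    (ht : 0 ≤ t) (hγ : 0 < γ)
    (hu' : ∀ s ∈ Set.Icc t (t + γ), 0 < deriv u s)
    (hbelow : y t < fan (u t)) :
    u t < Lam (y t) (u t) ∧
    ∃ ε₀ : ℝ, 0 < ε₀ ∧
      (∀ ε : ℝ, 0 < ε → ε ≤ γ → ε ≤ ε₀ → u (t + ε) ≤ Lam (y t) (u t) →
        ∀ τ ∈ Set.Icc (u (t + ε)) (Lam (y t) (u t)),
          ω τ (y (t + ε)) (u (t + ε)) = ω τ (y t) (u t)) ∧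
      ∀ τ ∈ Set.Ioc (u t) (Lam (y t) (u t)),
        Filter.Tendsto
          (fun ε : ℝ => (ω τ (y (t + ε)) (u (t + ε)) - ω τ (y t) (u t)) / ε)
          (nhdsWithin 0 (Set.Ioi 0)) (nhds 0) := by
  have hcurve : ∀ σ ξ, IsTraversingCurve f₁ f₂ ξ (fun τ => ω τ σ ξ) := fun σ ξ => (hω σ ξ).2
  have hint : ∀ T ∈ Ico 0 (t + γ + 1), IntervalIntegrable (fun s => f₁ (y s) (u s) *
      max 0 (deriv u s) + f₂ (y s) (u s) * min 0 (deriv u s)) volume 0 T := fun T hT =>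
    hy.intervalIntegrable hf₁ hf₂ hu (fun σ ξ => ⟨fun τ => ω τ σ ξ, (hω σ ξ).1, hcurve σ ξ⟩)
      (hA.exists_eventually_le hf₁.continuous hf₂.continuous)
      (hA.exists_eventually_ge han hf₁.continuous hf₂.continuous) hT.1
  have hmono : StrictMonoOn u (Icc t (t + γ)) :=
    strictMonoOn_of_deriv_pos (convex_Icc _ _) hu.continuous.continuousOn fun s hs =>
      hu' s (interior_subset hs)
  have htγ : t ∈ Icc t (t + γ) := ⟨le_rfl, by linarith⟩
  have hcω := (hcurve (y t) (u t)).continuous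
  have hyω : EqOn y (fun s => ω (u s) (y t) (u t)) (Icc t (t + γ)) := by
    refine eqOn_of_hasDerivWithinAt_mul hf₁ hu.continuous.continuousOn
      (hu.continuous_deriv le_rfl).continuousOn
      ((hy.continuousOn_of_intervalIntegrable hint).mono fun s hs =>
        ⟨ht.trans hs.1, by linarith [hs.2]⟩) (fun s hs => ?_)
      (hcω.comp hu.continuous).continuousOn (fun s hs => ?_) (hω (y t) (u t)).1.symm
    · have hd := hu' s (Ico_subset_Icc_self hs)
      have := hy.hasDerivWithinAt_of_intervalIntegrable hf₁ hf₂ hu hint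
        (t := s) ⟨ht.trans hs.1, by linarith [hs.2]⟩
      simpa [max_eq_right hd.le, min_eq_left hd.le] using this
    · have hd := hu' s (Ico_subset_Icc_self hs)
      have hus : u t ≤ u s := hmono.monotoneOn htγ (Ico_subset_Icc_self hs) hs.1
      have := HasDerivWithinAt.comp_right_of_left_right
        ((hcurve (y t) (u t)).hasDerivWithinAt_Ici (u s))
        ((hcurve (y t) (u t)).hasDerivWithinAt_Iic (u s))
        (hu.differentiable one_ne_zero s).hasDerivAt
      simpa [max_eq_right hd.le, min_eq_left hd.le, hus] using this
  have heq : ∀ ε, 0 < ε → ε ≤ γ → ∀ τ, u (t + ε) ≤ τ →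
      ω τ (y (t + ε)) (u (t + ε)) = ω τ (y t) (u t) := by
    intro ε hε hεγ τ hτ
    have hmem : t + ε ∈ Icc t (t + γ) := ⟨by linarith, by linarith⟩
    have hule : u t ≤ u (t + ε) := hmono.monotoneOn htγ hmem hmem.1
    refine eqOn_of_hasDerivWithinAt_mul (φ := fun s => ω s (y (t + ε)) (u (t + ε)))
      (ψ := fun s => ω s (y t) (u t)) (w := id) (k := fun _ => 1) hf₁ continuousOn_id
      continuousOn_const (hcurve _ _).continuous.continuousOn (fun s hs => ?_)
      hcω.continuousOn (fun s hs => ?_) ((hω _ _).1.trans (hyω hmem)) (right_mem_Icc.2 hτ)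
    · simpa [hs.1] using (hcurve (y (t + ε)) (u (t + ε))).hasDerivWithinAt_Ici s
    · simpa [hule.trans hs.1] using (hcurve (y t) (u t)).hasDerivWithinAt_Ici s
  refine ⟨(hLam.2 _ _).2 hbelow, γ, hγ, fun ε hε hεγ _ _ τ hτ => heq ε hε hεγ τ hτ.1,
    fun τ hτ => ?_⟩
  have hcu : ContinuousAt (fun ε => u (t + ε)) 0 :=
    (hu.continuous.comp (continuous_const.add continuous_id)).continuousAt
  have hlt : ∀ᶠ ε in 𝓝[>] (0 : ℝ), u (t + ε) < τ :=
    (hcu.eventually_lt_const (by simpa using hτ.1)).filter_mono nhdsWithin_le_nhds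
  refine tendsto_const_nhds.congr' ?_
  filter_upwards [hlt, Ioc_mem_nhdsGT hγ] with ε hετ hε
  rw [heq ε hε.1 hε.2 τ hετ.le, sub_self, zero_div]
end
end

section
/- Let ρ > 0, F_c > 0, u₀ ∈ ℝ and y₀ ∈ (−F_c, F_c). If y₀ ≥ 0, then u* := u₀ + (F_c/ρ)·ln(F_c/(y₀+F_c)) satisfies u* ≤ u₀ and −F_c + (y₀+F_c)·e^{ρ(u*−u₀)/F_c} = 0; if y₀ < 0, then u* := u₀ − (F_c/ρ)·ln(F_c/(F_c−y₀)) satisfies u* > u₀ and F_c + (y₀−F_c)·e^{ρ(u₀−u*)/F_c} = 0. Hence Λ(y₀,u₀) := u* defines an intersecting function of the Dahl model with r = 1, whose anhysteresis function is f_an ≡ 0; i.e. ω_Φ(Λ(y₀,u₀),y₀,u₀) = 0, with Λ(y₀,u₀) ≤ u₀ if y₀ ≥ 0 and Λ(y₀,u₀) > u₀ otherwise. -/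
open MeasureTheory Set Filter intervalIntegral

noncomputable section

/-- Explicit traversing function of the Dahl model with `r = 1`. -/
def dahlOmega (ρ Fc τ y₀ u₀ : ℝ) : ℝ :=
  if u₀ ≤ τ then Fc + (y₀ - Fc) * Real.exp (ρ * (u₀ - τ) / Fc)
  else -Fc + (y₀ + Fc) * Real.exp (ρ * (τ - u₀) / Fc)

/-- The intersecting function of the Dahl model with `r = 1`. -/
def dahlLambda (ρ Fc y₀ u₀ : ℝ) : ℝ :=
  if 0 ≤ y₀ then u₀ + Fc / ρ * Real.log (Fc / (y₀ + Fc))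
  else u₀ - Fc / ρ * Real.log (Fc / (Fc - y₀))

theorem exp_rescaled_log {ρ Fc a : ℝ} (hρ : ρ ≠ 0) (hFc : Fc ≠ 0) (ha : 0 < a) :
    Real.exp (ρ * (Fc / ρ * Real.log a) / Fc) = a := by
  rw [show ρ * (Fc / ρ * Real.log a) / Fc = Real.log a by field_simp, Real.exp_log ha]

theorem log_div_add_nonpos {Fc y : ℝ} (hFc : 0 < Fc) (hy : 0 ≤ y) :
    Real.log (Fc / (y + Fc)) ≤ 0 :=
  Real.log_nonpos (by positivity) ((div_le_one (by positivity)).2 (by linarith))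

theorem log_div_sub_neg {Fc y : ℝ} (hFc : 0 < Fc) (hy : y < 0) :
    Real.log (Fc / (Fc - y)) < 0 :=
  Real.log_neg (div_pos hFc (by linarith)) ((div_lt_one (by linarith)).2 (by linarith))

/-- the explicit crossing point of the Dahl traversing curve with the
anhysteresis curve `f_an ≡ 0`, and the fact that `dahlLambda` is an intersecting
function for the Dahl model. -/
theorem dahl_intersecting_explicit (ρ Fc u₀ y₀ : ℝ) (hρ : 0 < ρ) (hFc : 0 < Fc)
    (hy₀ : y₀ ∈ Set.Ioo (-Fc) Fc) :
    (0 ≤ y₀ →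
      u₀ + Fc / ρ * Real.log (Fc / (y₀ + Fc)) ≤ u₀ ∧
      -Fc + (y₀ + Fc) *
        Real.exp (ρ * ((u₀ + Fc / ρ * Real.log (Fc / (y₀ + Fc))) - u₀) / Fc) = 0) ∧
    (y₀ < 0 →
      u₀ < u₀ - Fc / ρ * Real.log (Fc / (Fc - y₀)) ∧
      Fc + (y₀ - Fc) *
        Real.exp (ρ * (u₀ - (u₀ - Fc / ρ * Real.log (Fc / (Fc - y₀)))) / Fc) = 0) ∧
    dahlOmega ρ Fc (dahlLambda ρ Fc y₀ u₀) y₀ u₀ = 0 ∧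
    (0 ≤ y₀ → dahlLambda ρ Fc y₀ u₀ ≤ u₀) ∧
    (y₀ < 0 → u₀ < dahlLambda ρ Fc y₀ u₀) := by
  have crossing_nonneg : 0 ≤ y₀ →
      u₀ + Fc / ρ * Real.log (Fc / (y₀ + Fc)) ≤ u₀ ∧
      -Fc + (y₀ + Fc) *
        Real.exp (ρ * ((u₀ + Fc / ρ * Real.log (Fc / (y₀ + Fc))) - u₀) / Fc) = 0 := by
    intro h
    have hpos : 0 < y₀ + Fc := by positivity
    refine ⟨?_, ?_⟩
    · linarith [mul_nonpos_of_nonneg_of_nonpos (div_pos hFc hρ).le (log_div_add_nonpos hFc h)]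
    · rw [add_sub_cancel_left, exp_rescaled_log hρ.ne' hFc.ne' (div_pos hFc hpos),
        mul_div_cancel₀ _ hpos.ne', neg_add_cancel]
  have crossing_neg : y₀ < 0 →
      u₀ < u₀ - Fc / ρ * Real.log (Fc / (Fc - y₀)) ∧
      Fc + (y₀ - Fc) *
        Real.exp (ρ * (u₀ - (u₀ - Fc / ρ * Real.log (Fc / (Fc - y₀)))) / Fc) = 0 := by
    intro h
    have hpos : 0 < Fc - y₀ := by linarith
    refine ⟨?_, ?_⟩
    · linarith [mul_neg_of_pos_of_neg (div_pos hFc hρ) (log_div_sub_neg hFc h)]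
    · rw [sub_sub_cancel, exp_rescaled_log hρ.ne' hFc.ne' (div_pos hFc hpos)]
      field_simp
      ring
  refine ⟨crossing_nonneg, crossing_neg, ?_, ?_, ?_⟩
  · rcases le_or_gt 0 y₀ with h | h
    · obtain ⟨hle, heq⟩ := crossing_nonneg h
      rw [dahlLambda, if_pos h, dahlOmega]
      split_ifs with hu
      · have hlog : Real.log (Fc / (y₀ + Fc)) = 0 :=
          le_antisymm (log_div_add_nonpos hFc h)
            (nonneg_of_mul_nonneg_right (by linarith) (div_pos hFc hρ))
        simp only [hlog, mul_zero, add_zero, sub_self, zero_div, Real.exp_zero, mul_one] at heq ⊢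
        linarith
      · exact heq
    · obtain ⟨hlt, heq⟩ := crossing_neg h
      rw [dahlLambda, if_neg h.not_ge, dahlOmega, if_pos hlt.le]
      exact heq
  · intro h
    rw [dahlLambda, if_pos h]
    exact (crossing_nonneg h).1
  · intro h
    rw [dahlLambda, if_neg h.not_ge]
    exact (crossing_neg h).1
end
end

section
/- Let ρ > 0 and F_c > 0. For every absolutely continuous input u : [0,∞) → ℝ and every y₀ ∈ (−F_c,F_c), let y be the Dahl output. Then the function t ↦ H_D(y(t)) is locally absolutely continuous and satisfies (d/dt) H_D(y(t)) ≤ y(t)·u̇(t) for almost every t ≥ 0. Consequently, ∫₀^T y(t)u̇(t) dt ≥ −H_D(y₀) for all T ≥ 0, so the Dahl operator is clockwise: liminf_{T→∞} ∫₀^T y(t)u̇(t) dt > −∞. -/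
open MeasureTheory Set Filter intervalIntegral

noncomputable section

/-- `y` is the output of the Dahl operator (`r = 1`) with parameters `ρ, F_c`,
input `u` (a.e. derivative `u'`) and initial value `y₀`, in integrated form. -/
def IsDahlSol (ρ Fc : ℝ) (u u' y : ℝ → ℝ) (y₀ : ℝ) : Prop :=
  y 0 = y₀ ∧
    ∀ t : ℝ, 0 ≤ t →
      y t = y₀ + ∫ s in (0:ℝ)..t,
        (ρ * (1 - y s / Fc) * max 0 (u' s) + ρ * (1 + y s / Fc) * min 0 (u' s))

/-- The closed-form storage function of the Dahl model with `r = 1`. -/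
def HD (ρ Fc σ : ℝ) : ℝ :=
  if 0 ≤ σ then Fc ^ 2 / ρ * Real.log (Fc / (σ + Fc)) + Fc / ρ * σ
  else Fc ^ 2 / ρ * Real.log (Fc / (Fc - σ)) - Fc / ρ * σ

theorem LipschitzWith.comp_absolutelyContinuousOnInterval {φ f : ℝ → ℝ} {K : NNReal} {a b : ℝ}
    (hφ : LipschitzWith K φ) (hf : AbsolutelyContinuousOnInterval f a b) :
    AbsolutelyContinuousOnInterval (fun t => φ (f t)) a b := by
  unfold AbsolutelyContinuousOnInterval at hf ⊢
  refine squeeze_zero (fun _ => Finset.sum_nonneg fun _ _ => dist_nonneg) (fun E => ?_)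
    (by simpa using hf.const_mul (K : ℝ))
  rw [Finset.mul_sum]
  exact Finset.sum_le_sum fun i _ => hφ.dist_le_mul _ _

/-- Chain rule for a function with bounded derivative along an absolutely continuous curve. -/
theorem integral_deriv_comp_mul_of_bounded_deriv {φ φ' y g : ℝ → ℝ} {C a b : ℝ}
    (hφ : ∀ x, HasDerivAt φ (φ' x) x) (hC : ∀ x, |φ' x| ≤ C)
    (hg : IntervalIntegrable g volume a b)
    (hy : ∀ t ∈ uIcc a b, y t = y a + ∫ s in a..t, g s) :
    IntervalIntegrable (fun t => φ' (y t) * g t) volume a b ∧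
      ∫ t in a..b, φ' (y t) * g t = φ (y b) - φ (y a) := by
  have hC0 : 0 ≤ C := (abs_nonneg _).trans (hC 0)
  have hlip : LipschitzWith C.toNNReal φ := by
    refine lipschitzWith_of_nnnorm_deriv_le (fun x => (hφ x).differentiableAt) fun x => ?_
    rw [(hφ x).deriv, ← NNReal.coe_le_coe, Real.coe_toNNReal _ hC0]
    exact hC x
  have hY : AbsolutelyContinuousOnInterval (fun t => y a + ∫ s in a..t, g s) a b := by
    have h₀ : AbsolutelyContinuousOnInterval (fun _ : ℝ => y a) a b :=
      (LipschitzWith.const (y a)).lipschitzOnWith.absolutelyContinuousOnInterval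
    exact h₀.add (hg.absolutelyContinuousOnInterval_intervalIntegral (c := a) (by simp))
  have hF := hlip.comp_absolutelyContinuousOnInterval hY
  have hderiv : ∀ᵐ t, t ∈ uIoc a b →
      deriv (fun t => φ (y a + ∫ s in a..t, g s)) t = φ' (y t) * g t := by
    filter_upwards [hg.ae_hasDerivAt_integral] with t ht htm
    have htm' := uIoc_subset_uIcc htm
    have h := (hφ (y a + ∫ s in a..t, g s)).comp t ((ht htm' a (by simp)).const_add (y a))
    rw [hy t htm']
    exact h.deriv
  refine ⟨hF.intervalIntegrable_deriv.congr_ae ?_, ?_⟩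
  · exact (ae_restrict_iff' measurableSet_uIoc).2 hderiv
  · rw [← integral_congr_ae hderiv, hF.integral_deriv_eq_sub, ← hy b (by simp)]
    simp

/-- Right-hand side of the Dahl model at input velocity `v` and output `σ`. -/
def dahlRate (ρ Fc v σ : ℝ) : ℝ :=
  ρ * (1 - σ / Fc) * max 0 v + ρ * (1 + σ / Fc) * min 0 v

theorem dahlRate_eq (ρ Fc v σ : ℝ) : dahlRate ρ Fc v σ = ρ * v - ρ * |v| / Fc * σ := by
  unfold dahlRate
  rcases le_total 0 v with h | h
  · rw [max_eq_right h, min_eq_left h, abs_of_nonneg h]; ring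
  · rw [max_eq_left h, min_eq_right h, abs_of_nonpos h]; ring

theorem intervalIntegrable_of_locallyIntegrableOn_Ici {f : ℝ → ℝ} {T : ℝ}
    (hf : LocallyIntegrableOn f (Ici 0)) (hT : 0 ≤ T) : IntervalIntegrable f volume 0 T :=
  (intervalIntegrable_iff_integrableOn_Icc_of_le hT).2
    (hf.integrableOn_compact_subset Icc_subset_Ici_self isCompact_Icc)

theorem locallyIntegrableOn_Ici_of_intervalIntegrable {f : ℝ → ℝ}
    (hf : ∀ T, 0 ≤ T → IntervalIntegrable f volume 0 T) : LocallyIntegrableOn f (Ici 0) := by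
  rw [locallyIntegrableOn_iff isClosed_Ici.isLocallyClosed]
  intro k hk hkc
  obtain ⟨B, hB⟩ := hkc.bddAbove
  refine ((intervalIntegrable_iff_integrableOn_Icc_of_le (le_max_left 0 B)).1
    (hf _ (le_max_left 0 B))).mono_set fun x hx => ⟨hk hx, (hB hx).trans (le_max_right _ _)⟩

theorem hasDerivAt_sqrt_one_add_sq (x : ℝ) :
    HasDerivAt (fun x : ℝ => √(1 + x ^ 2)) (x / √(1 + x ^ 2)) x := by
  have h := (((hasDerivAt_id x).pow 2).const_add 1).sqrt (f := fun x : ℝ => 1 + x ^ 2)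
    (by positivity)
  convert! h using 1
  simp
  field_simp

theorem abs_div_sqrt_one_add_sq_le (x : ℝ) : |x / √(1 + x ^ 2)| ≤ 1 := by
  have h : 0 < √(1 + x ^ 2) := by positivity
  rw [abs_div, abs_of_pos h, div_le_one h]
  exact Real.abs_le_sqrt (by linarith)

section Trajectory

variable {ρ Fc T : ℝ} {v y : ℝ → ℝ}

theorem abs_le_of_integral_dahlRate (hρ : 0 < ρ) (hFc : 0 < Fc) (hT : 0 ≤ T)
    (hv : IntervalIntegrable v volume 0 T)
    (hg : IntervalIntegrable (fun s => dahlRate ρ Fc (v s) (y s)) volume 0 T)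
    (hy : ∀ t, 0 ≤ t → y t = y 0 + ∫ s in (0:ℝ)..t, dahlRate ρ Fc (v s) (y s)) :
    |y T| ≤ √(1 + y 0 ^ 2) + ∫ s in (0:ℝ)..T, ρ * |v s| := by
  obtain ⟨hi, he⟩ := integral_deriv_comp_mul_of_bounded_deriv hasDerivAt_sqrt_one_add_sq
    abs_div_sqrt_one_add_sq_le hg (fun t ht => hy t (by rw [uIcc_of_le hT] at ht; exact ht.1))
  have hle := integral_mono_on hT hi (hv.abs.const_mul ρ) (fun s _ => ?_)
  · have : |y T| ≤ √(1 + y T ^ 2) := Real.abs_le_sqrt (by linarith)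
    linarith
  · have h := abs_le.1 (abs_div_sqrt_one_add_sq_le (y s))
    have hw : 0 < √(1 + y s ^ 2) := by positivity
    rw [dahlRate_eq]
    have h1 : 0 ≤ y s / √(1 + y s ^ 2) * (ρ * |v s| / Fc * y s) := by
      have : y s / √(1 + y s ^ 2) * (ρ * |v s| / Fc * y s)
        = y s ^ 2 / √(1 + y s ^ 2) * (ρ * |v s| / Fc) := by ring
      rw [this]; positivity
    have h2 : y s / √(1 + y s ^ 2) * v s ≤ |v s| := by
      refine (le_abs_self _).trans ?_
      rw [abs_mul]
      exact mul_le_of_le_one_left (abs_nonneg _) (abs_div_sqrt_one_add_sq_le _)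
    nlinarith

theorem continuousOn_setOf_intervalIntegrable {g : ℝ → ℝ} {c : ℝ}
    (hy : ∀ t, 0 ≤ t → y t = c + ∫ s in (0:ℝ)..t, g s) :
    ContinuousOn y {t | 0 ≤ t ∧ IntervalIntegrable g volume 0 t} := by
  have key : ∀ b, 0 ≤ b → IntervalIntegrable g volume 0 b → ContinuousOn y (Icc 0 b) := by
    intro b hb hgb
    have h := continuousOn_primitive_interval' hgb left_mem_uIcc
    rw [uIcc_of_le hb] at h
    exact (h.const_add c).congr fun t ht => hy t ht.1
  rintro t ⟨ht, hgt⟩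
  by_cases hex : ∃ b, t < b ∧ IntervalIntegrable g volume 0 b
  · obtain ⟨b, htb, hgb⟩ := hex
    refine (key b (ht.trans htb.le) hgb t ⟨ht, htb.le⟩).mono_of_mem_nhdsWithin ?_
    filter_upwards [self_mem_nhdsWithin, mem_nhdsWithin_of_mem_nhds (Iio_mem_nhds htb)]
      with x hx hxb using ⟨hx.1, hxb.le⟩
  · push Not at hex
    exact (key t ht hgt t ⟨ht, le_rfl⟩).mono fun x hx =>
      ⟨hx.1, not_lt.1 fun h => hex x h hx.2⟩

theorem measurableSet_setOf_intervalIntegrable (g : ℝ → ℝ) :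
    MeasurableSet {t | 0 ≤ t ∧ IntervalIntegrable g volume 0 t} := by
  refine OrdConnected.measurableSet ⟨?_⟩
  rintro a ⟨ha, -⟩ b ⟨hb, hgb⟩ x ⟨hax, hxb⟩
  refine ⟨ha.trans hax, hgb.mono_set ?_⟩
  rw [uIcc_of_le (ha.trans hax), uIcc_of_le hb]
  exact Icc_subset_Icc_right hxb

/-- The integral equation of the Dahl model forces its integrand to be integrable: otherwise the
integral takes its default value `0`, and `y` would be bounded nevertheless. -/
theorem intervalIntegrable_dahlRate (hρ : 0 < ρ) (hFc : 0 < Fc) (hT : 0 ≤ T)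
    (hv : IntervalIntegrable v volume 0 T)
    (hy : ∀ t, 0 ≤ t → y t = y 0 + ∫ s in (0:ℝ)..t, dahlRate ρ Fc (v s) (y s)) :
    IntervalIntegrable (fun s => dahlRate ρ Fc (v s) (y s)) volume 0 T := by
  set g := fun s => dahlRate ρ Fc (v s) (y s) with hgdef
  set S := {t | 0 ≤ t ∧ IntervalIntegrable g volume 0 t} with hS
  have hconst : ∀ t, 0 ≤ t → t ∉ S → y t = y 0 := by
    intro t ht htS
    rw [hy t ht, integral_undef fun h => htS ⟨ht, h⟩, add_zero]
  set B := √(1 + y 0 ^ 2) + ∫ s in (0:ℝ)..T, ρ * |v s| with hB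
  have hbound : ∀ t ∈ Ioc 0 T, |y t| ≤ B := by
    intro t ht
    have hsub : uIcc 0 t ⊆ uIcc 0 T := by
      rw [uIcc_of_le ht.1.le, uIcc_of_le hT]; exact Icc_subset_Icc_right ht.2
    have hmono : ∫ s in (0:ℝ)..t, ρ * |v s| ≤ ∫ s in (0:ℝ)..T, ρ * |v s| :=
      integral_mono_interval le_rfl ht.1.le ht.2
        (Eventually.of_forall fun s => by simp only [Pi.zero_apply]; positivity)
        (hv.abs.const_mul ρ)
    by_cases htS : t ∈ S
    · exact (abs_le_of_integral_dahlRate hρ hFc ht.1.le (hv.mono_set hsub) htS.2 hy).trans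
        (by linarith)
    · rw [hconst t ht.1.le htS]
      have h1 : |y 0| ≤ √(1 + y 0 ^ 2) := Real.abs_le_sqrt (by linarith)
      have h2 : 0 ≤ ∫ s in (0:ℝ)..T, ρ * |v s| :=
        integral_nonneg hT fun s _ => by positivity
      linarith
  have hSm : MeasurableSet S := measurableSet_setOf_intervalIntegrable g
  have hmeas : AEStronglyMeasurable y (volume.restrict (Ioc 0 T)) := by
    have h1 : AEStronglyMeasurable y (volume.restrict S) :=
      (continuousOn_setOf_intervalIntegrable hy).aestronglyMeasurable hSm
    have h2 : AEStronglyMeasurable y (volume.restrict (Ici 0 \ S)) :=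
      (aestronglyMeasurable_const (b := y 0)).congr
        ((ae_restrict_iff' (measurableSet_Ici.diff hSm)).2
          (Eventually.of_forall fun t ht => (hconst t ht.1 ht.2).symm))
    refine (aestronglyMeasurable_union_iff.2 ⟨h1, h2⟩).mono_set fun t ht => ?_
    by_cases htS : t ∈ S
    · exact Or.inl htS
    · exact Or.inr ⟨ht.1.le, htS⟩
  rw [intervalIntegrable_iff_integrableOn_Ioc_of_le hT] at hv ⊢
  have hprod : IntegrableOn (fun s => y s * (ρ * |v s| / Fc)) (Ioc 0 T) :=
    Integrable.bdd_mul (c := B) ((hv.abs.const_mul ρ).div_const Fc) hmeas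
      ((ae_restrict_iff' measurableSet_Ioc).2 (Eventually.of_forall hbound))
  refine ((hv.const_mul ρ).sub hprod).congr (Eventually.of_forall fun s => ?_)
  simp only [hgdef, dahlRate_eq, Pi.sub_apply]
  ring

end Trajectory

section Storage

variable {ρ Fc : ℝ}

theorem HD_eq_abs (ρ Fc σ : ℝ) :
    HD ρ Fc σ = Fc ^ 2 / ρ * Real.log (Fc / (|σ| + Fc)) + Fc / ρ * |σ| := by
  unfold HD
  split_ifs with h
  · rw [abs_of_nonneg h]
  · rw [abs_of_neg (not_le.1 h), neg_add_eq_sub]; ring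

theorem HD_nonneg (hρ : 0 < ρ) (hFc : 0 < Fc) (σ : ℝ) : 0 ≤ HD ρ Fc σ := by
  rw [HD_eq_abs]
  have hpos : 0 < |σ| + Fc := by positivity
  have hlog := Real.one_sub_inv_le_log_of_pos (div_pos hFc hpos)
  have h : Fc ^ 2 / ρ * (1 - (Fc / (|σ| + Fc))⁻¹) + Fc / ρ * |σ| = 0 := by
    field_simp; ring
  have := mul_le_mul_of_nonneg_left hlog (by positivity : 0 ≤ Fc ^ 2 / ρ)
  linarith

theorem hasDerivAt_HD_nonneg_branch (hρ : 0 < ρ) (hFc : 0 < Fc) {σ : ℝ} (hσ : 0 ≤ σ) :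
    HasDerivAt (fun x => Fc ^ 2 / ρ * Real.log (Fc / (x + Fc)) + Fc / ρ * x)
      (Fc / ρ * (σ / (Fc + |σ|))) σ := by
  have hpos : 0 < σ + Fc := by positivity
  have h1 := ((hasDerivAt_const σ Fc).div ((hasDerivAt_id σ).add_const Fc) hpos.ne').log
    (div_pos hFc hpos).ne'
  have h2 := (h1.const_mul (Fc ^ 2 / ρ)).add ((hasDerivAt_id σ).const_mul (Fc / ρ))
  convert! h2 using 1
  rw [abs_of_nonneg hσ]
  have : Fc + σ ≠ 0 := by positivity
  simp
  field_simp
  ring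

theorem HD_neg (ρ Fc σ : ℝ) : HD ρ Fc (-σ) = HD ρ Fc σ := by
  simp only [HD_eq_abs, abs_neg]

theorem hasDerivAt_HD_of_nonneg (hρ : 0 < ρ) (hFc : 0 < Fc) {σ : ℝ} (hσ : 0 ≤ σ) :
    HasDerivAt (HD ρ Fc) (Fc / ρ * (σ / (Fc + |σ|))) σ := by
  have hIci : ∀ {τ : ℝ}, 0 ≤ τ →
      HasDerivWithinAt (HD ρ Fc) (Fc / ρ * (τ / (Fc + |τ|))) (Ici 0) τ := fun {τ} hτ =>
    (hasDerivAt_HD_nonneg_branch hρ hFc hτ).hasDerivWithinAt.congr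
      (fun x hx => if_pos hx) (if_pos hτ)
  rcases hσ.eq_or_lt with rfl | hpos
  · have h := hIci le_rfl
    have h' : HasDerivWithinAt (HD ρ Fc) (Fc / ρ * (0 / (Fc + |0|))) (Iic 0) 0 := by
      have hb := (hasDerivAt_HD_nonneg_branch hρ hFc le_rfl)
      rw [← neg_zero] at hb
      have hc := hb.comp (0 : ℝ) (hasDerivAt_neg 0)
      simp only [neg_zero, zero_div, mul_zero, zero_mul] at hc ⊢
      refine hc.hasDerivWithinAt.congr (fun x hx => ?_) ?_
      · rw [← HD_neg]; exact if_pos (neg_nonneg.2 hx)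
      · rw [← HD_neg]; exact if_pos (by simp)
    have := h'.union h
    rwa [Iic_union_Ici, hasDerivWithinAt_univ] at this
  · exact (hIci hσ).hasDerivAt (Ici_mem_nhds hpos)

theorem hasDerivAt_HD (hρ : 0 < ρ) (hFc : 0 < Fc) (σ : ℝ) :
    HasDerivAt (HD ρ Fc) (Fc / ρ * (σ / (Fc + |σ|))) σ := by
  rcases le_total 0 σ with h | h
  · exact hasDerivAt_HD_of_nonneg hρ hFc h
  · have h1 := (hasDerivAt_HD_of_nonneg hρ hFc (neg_nonneg.2 h)).comp σ (hasDerivAt_neg σ)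
    convert! h1 using 1
    · funext x; exact (HD_neg ρ Fc x).symm
    · rw [abs_neg]; ring

theorem abs_deriv_HD_le (hρ : 0 < ρ) (hFc : 0 < Fc) (σ : ℝ) :
    |Fc / ρ * (σ / (Fc + |σ|))| ≤ Fc / ρ := by
  have hpos : 0 < Fc + |σ| := by positivity
  rw [abs_mul, abs_of_pos (div_pos hFc hρ), abs_div, abs_of_pos hpos]
  refine mul_le_of_le_one_right (by positivity) ((div_le_one hpos).2 (by linarith))

theorem deriv_HD_mul_dahlRate_le (hρ : 0 < ρ) (hFc : 0 < Fc) (v σ : ℝ) :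
    Fc / ρ * (σ / (Fc + |σ|)) * dahlRate ρ Fc v σ ≤ σ * v := by
  have hpos : 0 < Fc + |σ| := by positivity
  have h : Fc / ρ * (σ / (Fc + |σ|)) * dahlRate ρ Fc v σ
      = (Fc * (σ * v) - |v| * |σ| ^ 2) / (Fc + |σ|) := by
    rw [dahlRate_eq, sq_abs]; field_simp
  rw [h, div_le_iff₀ hpos]
  have h1 : 0 ≤ |σ| * |v| + σ * v := by
    rw [← abs_mul]; linarith [neg_abs_le (σ * v)]
  nlinarith [mul_nonneg (abs_nonneg σ) h1]

end Storage

/-- along every Dahl trajectory, `t ↦ H_D(y(t))` is locally absolutely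
continuous with a.e. derivative bounded by `y(t)·u̇(t)`; consequently
`∫₀^T y u̇ ≥ −H_D(y₀)` for all `T ≥ 0` and the Dahl operator is clockwise. -/
theorem dahl_dissipativity_clockwise (ρ Fc : ℝ) (hρ : 0 < ρ) (hFc : 0 < Fc)
    (u u' y : ℝ → ℝ) (y₀ : ℝ)
    (hu : IsAbsCont u u') (hy₀ : y₀ ∈ Set.Ioo (-Fc) Fc)
    (hy : IsDahlSol ρ Fc u u' y y₀) :
    (∃ h' : ℝ → ℝ,
      MeasureTheory.LocallyIntegrableOn h' (Set.Ici 0) ∧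
      (∀ T : ℝ, 0 ≤ T → HD ρ Fc (y T) = HD ρ Fc y₀ + ∫ t in (0:ℝ)..T, h' t) ∧
      (∀ᵐ t : ℝ, 0 ≤ t → h' t ≤ y t * u' t)) ∧
    (∀ T : ℝ, 0 ≤ T → -(HD ρ Fc y₀) ≤ ∫ t in (0:ℝ)..T, y t * u' t) ∧
    Clockwise u' y := by
  obtain ⟨hy0, hy⟩ := hy
  subst hy0
  have hy : ∀ t, 0 ≤ t → y t = y 0 + ∫ s in (0:ℝ)..t, dahlRate ρ Fc (u' s) (y s) := hy
  have hv : ∀ T, 0 ≤ T → IntervalIntegrable u' volume 0 T := fun T hT =>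
    intervalIntegrable_of_locallyIntegrableOn_Ici hu.1 hT
  have hg : ∀ T, 0 ≤ T → IntervalIntegrable (fun s => dahlRate ρ Fc (u' s) (y s)) volume 0 T :=
    fun T hT => intervalIntegrable_dahlRate hρ hFc hT (hv T hT) hy
  have hchain := fun T (hT : 0 ≤ T) =>
    integral_deriv_comp_mul_of_bounded_deriv (hasDerivAt_HD hρ hFc) (abs_deriv_HD_le hρ hFc)
      (hg T hT) (fun t ht => hy t (by rw [uIcc_of_le hT] at ht; exact ht.1))
  have hlower : ∀ T : ℝ, 0 ≤ T → -(HD ρ Fc (y 0)) ≤ ∫ t in (0:ℝ)..T, y t * u' t := by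
    intro T hT
    have hcont : ContinuousOn y (uIcc 0 T) := by
      rw [uIcc_of_le hT]
      exact (continuousOn_setOf_intervalIntegrable hy).mono fun t ht => ⟨ht.1, hg t ht.1⟩
    have hle := integral_mono_on hT (hchain T hT).1 ((hv T hT).continuousOn_mul hcont)
      fun t _ => deriv_HD_mul_dahlRate_le hρ hFc (u' t) (y t)
    linarith [(hchain T hT).2, HD_nonneg hρ hFc (y T)]
  refine ⟨⟨fun t => Fc / ρ * (y t / (Fc + |y t|)) * dahlRate ρ Fc (u' t) (y t),
    locallyIntegrableOn_Ici_of_intervalIntegrable fun T hT => (hchain T hT).1,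
    fun T hT => by rw [(hchain T hT).2]; ring,
    Eventually.of_forall fun t _ => deriv_HD_mul_dahlRate_le hρ hFc (u' t) (y t)⟩, hlower, ?_⟩
  refine (EReal.bot_lt_coe (-(HD ρ Fc (y 0)))).trans_le (le_liminf_of_le (by isBoundedDefault) ?_)
  filter_upwards [eventually_ge_atTop 0] with T hT
  exact EReal.coe_le_coe_iff.2 (hlower T hT)
end
end

section
/- Let m, d, k, ρ, F_c > 0 and let (x₁,x₂,x₃) : [0,∞) → ℝ³ be a solution of the mass–spring–damper system with Dahl friction with x₃(0) ∈ (−F_c,F_c). Then the trajectory (x₁,x₂) is bounded, x₃(t) ∈ (−F_c,F_c) for all t ≥ 0, and as t → ∞ the state converges to the largest invariant set where x₂ = 0, namely {(a,b,c) : k·a = −c, b = 0}; in particular x₂(t) → 0 and k·x₁(t) + x₃(t) → 0 as t → ∞. -/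
open MeasureTheory Set Filter intervalIntegral

noncomputable section

/-- `(x₁,x₂,x₃)` is a solution on `[0,∞)` of the mass-spring-damper system with Dahl
friction: `ẋ₁ = x₂`, `ẋ₂ = −(k/m)x₁ − (d/m)x₂ − (1/m)x₃`,
`ẋ₃ = ρ(1 − x₃/F_c) max{0,x₂} + ρ(1 + x₃/F_c) min{0,x₂}`. -/
def IsMSDDahlSol (m d k ρ Fc : ℝ) (x₁ x₂ x₃ : ℝ → ℝ) : Prop :=
  ∀ t : ℝ, 0 ≤ t →
    HasDerivWithinAt x₁ (x₂ t) (Set.Ici 0) t ∧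
    HasDerivWithinAt x₂ (-(k / m) * x₁ t - (d / m) * x₂ t - (1 / m) * x₃ t)
      (Set.Ici 0) t ∧
    HasDerivWithinAt x₃
      (ρ * (1 - x₃ t / Fc) * max 0 (x₂ t) + ρ * (1 + x₃ t / Fc) * min 0 (x₂ t))
      (Set.Ici 0) t

theorem monotoneOn_Ici_of_hasDerivWithinAt_nonneg {f f' : ℝ → ℝ} {a : ℝ}
    (hf : ∀ t, a ≤ t → HasDerivWithinAt f (f' t) (Ici a) t) (hf' : ∀ t, a ≤ t → 0 ≤ f' t) :
    MonotoneOn f (Ici a) :=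
  monotoneOn_of_hasDerivWithinAt_nonneg (convex_Ici a)
    (fun t ht => (hf t ht).continuousWithinAt)
    (fun t ht => (hf t (interior_subset ht)).mono interior_subset)
    (fun t ht => hf' t (interior_subset ht))

/-- A Grönwall-type positivity criterion for the differential inequality `u' ≥ -p u`. -/
theorem pos_of_hasDerivWithinAt_ge_neg_mul {u u' p : ℝ → ℝ}
    (hu : ∀ t, 0 ≤ t → HasDerivWithinAt u (u' t) (Ici 0) t)
    (hp : ContinuousOn p (Ici 0)) (hle : ∀ t, 0 ≤ t → -(p t * u t) ≤ u' t)
    (h0 : 0 < u 0) {t : ℝ} (ht : 0 ≤ t) : 0 < u t := by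
  have hq : Continuous fun s => p (max 0 s) :=
    hp.comp_continuous (by fun_prop) fun s => le_max_left 0 s
  set P : ℝ → ℝ := fun t => ∫ s in (0 : ℝ)..t, p (max 0 s)
  have hPd : ∀ t, 0 ≤ t → HasDerivWithinAt P (p t) (Ici 0) t := fun t ht => by
    have h := (integral_hasDerivAt_right (hq.intervalIntegrable 0 t)
      (hq.stronglyMeasurableAtFilter _ _) hq.continuousAt).hasDerivWithinAt (s := Ici 0)
    rwa [max_eq_right ht] at h
  have hmono := monotoneOn_Ici_of_hasDerivWithinAt_nonneg
    (fun t ht => (hu t ht).mul (hPd t ht).exp) (fun t ht => by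
      have := mul_nonneg (sub_nonneg.2 (hle t ht)) (Real.exp_pos (P t)).le
      linarith)
  have h := hmono self_mem_Ici ht ht
  simp only [Pi.mul_apply] at h
  exact pos_of_mul_pos_left ((mul_pos h0 (Real.exp_pos _)).trans_le h) (Real.exp_pos _).le

/-- A one-sided form of Barbalat's lemma. -/
theorem eventually_lt_of_tendsto_of_deriv_le_neg {f f' g g' : ℝ → ℝ} {c L : ℝ}
    (hf : ∀ t, 0 ≤ t → HasDerivWithinAt f (f' t) (Ici 0) t)
    (hg : ∀ t, 0 ≤ t → HasDerivWithinAt g (g' t) (Ici 0) t)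
    (hlim : Tendsto f atTop (nhds c)) (hfg : ∀ t, 0 ≤ t → f' t ≤ -g t)
    (hL : 0 < L) (hg' : ∀ t, 0 ≤ t → -L ≤ g' t) {ε : ℝ} (hε : 0 < ε) :
    ∀ᶠ t in atTop, g t < ε := by
  have hdrop : Tendsto (fun t => f t - f (t + ε / L)) atTop (nhds 0) := by
    simpa using hlim.sub (hlim.comp (tendsto_atTop_add_const_right atTop (ε / L) tendsto_id))
  have hsmall : 0 < ε ^ 2 / (2 * L) := by positivity
  filter_upwards [hdrop.eventually_lt_const hsmall, eventually_ge_atTop 0] with t ht ht0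
  by_contra! hgt
  have hsub : Ici t ⊆ Ici (0 : ℝ) := Ici_subset_Ici.2 ht0
  have hgmono := monotoneOn_Ici_of_hasDerivWithinAt_nonneg
    (fun s hs => (hg s hs).add ((hasDerivWithinAt_id s (Ici 0)).const_mul L))
    (fun s hs => by linarith [hg' s hs])
  have hglow : ∀ s, t ≤ s → ε - L * (s - t) ≤ g s := fun s hs => by
    have := hgmono ht0 (ht0.trans hs) hs
    simp only [Pi.add_apply, id] at this
    linarith
  have hfmono := monotoneOn_Ici_of_hasDerivWithinAt_nonneg (a := t)
    (f := fun s => L / 2 * (s - t) ^ 2 - ε * (s - t) - f s)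
    (f' := fun s => L * (s - t) - ε - f' s)
    (fun s hs => by
      have h1 : HasDerivWithinAt (fun s => s - t) 1 (Ici t) s :=
        (hasDerivWithinAt_id s (Ici t)).sub_const t
      have := (((h1.pow 2).const_mul (L / 2)).sub (h1.const_mul ε)).sub
        ((hf s (ht0.trans hs)).mono hsub)
      refine this.congr_deriv ?_
      push_cast
      ring)
    (fun s hs => by linarith [hglow s hs, hfg s (ht0.trans hs)])
  have hstep : t ≤ t + ε / L := le_add_of_nonneg_right (by positivity)
  have h := hfmono self_mem_Ici hstep hstep
  have heq : L / 2 * (ε / L) ^ 2 - ε * (ε / L) = -(ε ^ 2 / (2 * L)) := by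
    field_simp
    ring
  simp only [add_sub_cancel_left, sub_self] at h
  linarith

theorem exists_tendsto_of_antitoneOn_Ici {f : ℝ → ℝ} {b : ℝ} (hf : AntitoneOn f (Ici 0))
    (hb : ∀ t, 0 ≤ t → b ≤ f t) : ∃ c, Tendsto f atTop (nhds c) := by
  have hanti : Antitone fun t => f (max 0 t) := fun s t hst =>
    hf (le_max_left 0 s) (le_max_left 0 t) (max_le_max_left 0 hst)
  have hbdd : BddBelow (range fun t => f (max 0 t)) :=
    ⟨b, by rintro _ ⟨t, rfl⟩; exact hb _ (le_max_left 0 t)⟩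
  refine ⟨_, (tendsto_atTop_ciInf hanti hbdd).congr' ?_⟩
  filter_upwards [eventually_ge_atTop 0] with t ht
  rw [max_eq_right ht]

/-- If `v` converges and its second derivative is bounded, then its derivative tends to zero. -/
theorem tendsto_deriv_zero_of_tendsto {v a a' : ℝ → ℝ} {c L : ℝ}
    (hv : ∀ t, 0 ≤ t → HasDerivWithinAt v (a t) (Ici 0) t)
    (ha : ∀ t, 0 ≤ t → HasDerivWithinAt a (a' t) (Ici 0) t)
    (hlim : Tendsto v atTop (nhds c)) (hL : 0 < L) (ha' : ∀ t, 0 ≤ t → |a' t| ≤ L) :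
    Tendsto a atTop (nhds 0) := by
  rw [Metric.tendsto_nhds]
  intro ε hε
  have hup := eventually_lt_of_tendsto_of_deriv_le_neg (fun t ht => (hv t ht).neg) ha hlim.neg
    (fun t _ => le_rfl) hL (fun t ht => (abs_le.1 (ha' t ht)).1) hε
  have hlow := eventually_lt_of_tendsto_of_deriv_le_neg hv (fun t ht => (ha t ht).neg) hlim
    (fun t _ => by simp) hL (fun t ht => neg_le_neg (abs_le.1 (ha' t ht)).2) hε
  filter_upwards [hup, hlow] with t h1 h2
  rw [Real.dist_eq, sub_zero, abs_lt]
  exact ⟨by simp only [Pi.neg_apply] at h2; linarith, h1⟩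

theorem dahl_rhs_eq {ρ Fc v z : ℝ} :
    ρ * (1 - z / Fc) * max 0 v + ρ * (1 + z / Fc) * min 0 v = ρ * v - ρ / Fc * z * |v| := by
  rcases le_total 0 v with h | h
  · rw [max_eq_right h, min_eq_left h, abs_of_nonneg h]; ring
  · rw [max_eq_left h, min_eq_right h, abs_of_nonpos h]; ring

/-- for the mass-spring-damper system with Dahl friction, `(x₁,x₂)` is
bounded, `x₃` stays in `(−F_c,F_c)`, and the state converges to the largest invariant
set where `x₂ = 0`, namely `{(a,b,c) : k·a = −c, b = 0}`; in particular `x₂(t) → 0` and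
`k·x₁(t) + x₃(t) → 0` as `t → ∞`. -/
theorem msd_dahl_convergence (m d k ρ Fc : ℝ)
    (hm : 0 < m) (hd : 0 < d) (hk : 0 < k) (hρ : 0 < ρ) (hFc : 0 < Fc)
    (x₁ x₂ x₃ : ℝ → ℝ)
    (hsol : IsMSDDahlSol m d k ρ Fc x₁ x₂ x₃)
    (hx₃0 : x₃ 0 ∈ Set.Ioo (-Fc) Fc) :
    (∃ M : ℝ, ∀ t : ℝ, 0 ≤ t → |x₁ t| ≤ M ∧ |x₂ t| ≤ M) ∧
    (∀ t : ℝ, 0 ≤ t → x₃ t ∈ Set.Ioo (-Fc) Fc) ∧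
    Filter.Tendsto
      (fun t => Metric.infDist (x₁ t, x₂ t, x₃ t)
        {p : ℝ × ℝ × ℝ | k * p.1 = -p.2.2 ∧ p.2.1 = 0})
      Filter.atTop (nhds 0) ∧
    Filter.Tendsto x₂ Filter.atTop (nhds 0) ∧
    Filter.Tendsto (fun t => k * x₁ t + x₃ t) Filter.atTop (nhds 0) := by
  have h₁ : ∀ t, 0 ≤ t → HasDerivWithinAt x₁ (x₂ t) (Ici 0) t := fun t ht => (hsol t ht).1
  set a : ℝ → ℝ := fun t => -(k / m) * x₁ t - (d / m) * x₂ t - (1 / m) * x₃ t with ha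
  have h₂ : ∀ t, 0 ≤ t → HasDerivWithinAt x₂ (a t) (Ici 0) t := fun t ht => (hsol t ht).2.1
  set b : ℝ → ℝ := fun t => ρ * x₂ t - ρ / Fc * x₃ t * |x₂ t| with hb
  have h₃ : ∀ t, 0 ≤ t → HasDerivWithinAt x₃ (b t) (Ici 0) t := fun t ht =>
    (hsol t ht).2.2.congr_deriv dahl_rhs_eq
  have hcont : ContinuousOn (fun t => ρ / Fc * |x₂ t|) (Ici 0) :=
    continuousOn_const.mul (fun t ht => (h₂ t ht).continuousWithinAt.abs)
  have hz : ∀ t, 0 ≤ t → x₃ t ∈ Ioo (-Fc) Fc := fun t ht => by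
    have hup := pos_of_hasDerivWithinAt_ge_neg_mul (u := fun t => Fc - x₃ t)
      (fun t ht => (h₃ t ht).const_sub Fc) hcont (fun t _ => by
        have := mul_le_mul_of_nonneg_left (le_abs_self (x₂ t)) hρ.le
        have e : ρ / Fc * |x₂ t| * (Fc - x₃ t) = ρ * |x₂ t| - ρ / Fc * x₃ t * |x₂ t| := by
          field_simp
        simp only [hb, e]
        linarith) (sub_pos.2 hx₃0.2) ht
    have hlow := pos_of_hasDerivWithinAt_ge_neg_mul (u := fun t => Fc + x₃ t)
      (fun t ht => (h₃ t ht).const_add Fc) hcont (fun t _ => by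
        have := mul_le_mul_of_nonneg_left (neg_abs_le (x₂ t)) hρ.le
        have e : ρ / Fc * |x₂ t| * (Fc + x₃ t) = ρ * |x₂ t| + ρ / Fc * x₃ t * |x₂ t| := by
          field_simp
        simp only [hb, e]
        linarith) (by linarith [hx₃0.1]) ht
    exact ⟨by linarith, by linarith⟩
  set V : ℝ → ℝ := fun t => m / 2 * x₂ t ^ 2 + k / 2 * x₁ t ^ 2 + 1 / (2 * ρ) * x₃ t ^ 2 with hV
  have hVd : ∀ t, 0 ≤ t → HasDerivWithinAt V (-(d * x₂ t ^ 2) - x₃ t ^ 2 * |x₂ t| / Fc)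
      (Ici 0) t := fun t ht => by
    have := ((((h₂ t ht).pow 2).const_mul (m / 2)).add
      (((h₁ t ht).pow 2).const_mul (k / 2))).add (((h₃ t ht).pow 2).const_mul (1 / (2 * ρ)))
    refine this.congr_deriv ?_
    simp only [ha, hb]
    push_cast
    field_simp
    ring
  have hVle : ∀ t, 0 ≤ t → -(d * x₂ t ^ 2) - x₃ t ^ 2 * |x₂ t| / Fc ≤ -(d * x₂ t ^ 2) :=
    fun t _ => sub_le_self _ (by positivity)
  have hVanti : AntitoneOn V (Ici 0) := by
    have hmono := monotoneOn_Ici_of_hasDerivWithinAt_nonneg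
      (fun t ht => (hVd t ht).neg) fun t ht => by
        have : 0 ≤ d * x₂ t ^ 2 := by positivity
        linarith [hVle t ht]
    exact fun s hs t ht hst => neg_le_neg_iff.1 (hmono hs ht hst)
  obtain ⟨c, hc⟩ := exists_tendsto_of_antitoneOn_Ici (b := 0) hVanti
    (fun t _ => by simp only [hV]; positivity)
  obtain ⟨M, hM0, hM⟩ : ∃ M : ℝ, 0 < M ∧ ∀ t, 0 ≤ t → |x₁ t| ≤ M ∧ |x₂ t| ≤ M := by
    have hV0 : 0 ≤ V 0 := by simp only [hV]; positivity
    refine ⟨1 + 2 * V 0 / k + 2 * V 0 / m, by positivity, fun t ht => ?_⟩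
    have hle : V t ≤ V 0 := hVanti self_mem_Ici ht ht
    have hk0 : 0 ≤ 2 * V 0 / k := by positivity
    have hm0 : 0 ≤ 2 * V 0 / m := by positivity
    have hm' : 0 ≤ m / 2 * x₂ t ^ 2 := by positivity
    have hk' : 0 ≤ k / 2 * x₁ t ^ 2 := by positivity
    have hρ' : 0 ≤ 1 / (2 * ρ) * x₃ t ^ 2 := by positivity
    have hVt : V t = m / 2 * x₂ t ^ 2 + k / 2 * x₁ t ^ 2 + 1 / (2 * ρ) * x₃ t ^ 2 := rfl
    have e1 : x₁ t ^ 2 ≤ 2 * V 0 / k := by rw [le_div_iff₀ hk]; linarith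
    have e2 : x₂ t ^ 2 ≤ 2 * V 0 / m := by rw [le_div_iff₀ hm]; linarith
    constructor <;> refine abs_le_of_sq_le_sq ?_ (by positivity) <;> nlinarith
  have hzabs : ∀ t, 0 ≤ t → |x₃ t| ≤ Fc := fun t ht => (abs_lt.2 (hz t ht)).le
  have hbM : ∀ t, 0 ≤ t → |b t| ≤ 2 * ρ * |x₂ t| := fun t ht => by
    have e : abs (ρ / Fc * x₃ t * |x₂ t|) = ρ / Fc * |x₃ t| * |x₂ t| := by
      rw [abs_mul, abs_mul, abs_abs, abs_of_pos (div_pos hρ hFc)]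
    have hle : ρ / Fc * |x₃ t| * |x₂ t| ≤ ρ / Fc * Fc * |x₂ t| := by
      gcongr
      exact hzabs t ht
    rw [div_mul_cancel₀ _ hFc.ne'] at hle
    have := abs_sub (ρ * x₂ t) (ρ / Fc * x₃ t * |x₂ t|)
    rw [e, abs_mul, abs_of_pos hρ] at this
    linarith
  have hlin : ∀ x v z X Y Z : ℝ, |x| ≤ X → |v| ≤ Y → |z| ≤ Z →
      |-(k / m) * x - (d / m) * v - (1 / m) * z| ≤ k / m * X + d / m * Y + 1 / m * Z := by
    intro x v z X Y Z hx hv hz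
    have e1 := mul_le_mul_of_nonneg_left hx (div_pos hk hm).le
    have e2 := mul_le_mul_of_nonneg_left hv (div_pos hd hm).le
    have e3 := mul_le_mul_of_nonneg_left hz (one_div_pos.2 hm).le
    have e4 := abs_sub (-(k / m) * x - (d / m) * v) ((1 / m) * z)
    have e5 := abs_sub (-(k / m) * x) ((d / m) * v)
    rw [abs_mul, abs_of_pos (one_div_pos.2 hm)] at e4
    rw [abs_mul, abs_mul, abs_neg, abs_of_pos (div_pos hk hm), abs_of_pos (div_pos hd hm)] at e5
    linarith
  set A : ℝ := k / m * M + d / m * M + 1 / m * Fc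
  have hA0 : 0 < A := by positivity
  have haA : ∀ t, 0 ≤ t → |a t| ≤ A := fun t ht =>
    hlin _ _ _ _ _ _ (hM t ht).1 (hM t ht).2 (hzabs t ht)
  have had : ∀ t, 0 ≤ t → HasDerivWithinAt a
      (-(k / m) * x₂ t - (d / m) * a t - (1 / m) * b t) (Ici 0) t := fun t ht =>
    (((h₁ t ht).const_mul _).sub ((h₂ t ht).const_mul _)).sub ((h₃ t ht).const_mul _)
  have hv0 : Tendsto x₂ atTop (nhds 0) := by
    rw [Metric.tendsto_nhds]
    intro ε hε
    have hev := eventually_lt_of_tendsto_of_deriv_le_neg (L := 2 * d * (M * A)) hVd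
      (fun t ht => ((h₂ t ht).pow 2).const_mul d) hc hVle (by positivity) (fun t ht => by
        have hva : |x₂ t * a t| ≤ M * A := by
          rw [abs_mul]
          exact mul_le_mul (hM t ht).2 (haA t ht) (abs_nonneg _) hM0.le
        have := mul_le_mul_of_nonneg_left (abs_le.1 hva).1 (by positivity : 0 ≤ 2 * d)
        push_cast
        linarith) (by positivity : 0 < d * ε ^ 2)
    filter_upwards [hev] with t ht
    rw [Real.dist_eq, sub_zero]
    exact abs_lt_of_sq_lt_sq (lt_of_mul_lt_mul_left ht hd.le) hε.le
  have ha0 : Tendsto a atTop (nhds 0) :=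
    tendsto_deriv_zero_of_tendsto (L := k / m * M + d / m * A + 1 / m * (2 * ρ * M)) h₂ had hv0
      (by positivity) fun t ht => hlin _ _ _ _ _ _ (hM t ht).2 (haA t ht)
        ((hbM t ht).trans (mul_le_mul_of_nonneg_left (hM t ht).2 (by positivity)))
  have hy0 : Tendsto (fun t => k * x₁ t + x₃ t) atTop (nhds 0) := by
    have h := (ha0.const_mul (-m)).sub (hv0.const_mul d)
    simp only [mul_zero, sub_zero] at h
    refine h.congr fun t => ?_
    simp only [ha]
    field_simp
    ring
  refine ⟨⟨M, hM⟩, hz, ?_, hv0, hy0⟩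
  have hbound : Tendsto (fun t => |k * x₁ t + x₃ t| / k + |x₂ t|) atTop (nhds 0) := by
    simpa using (hy0.abs.div_const k).add hv0.abs
  refine squeeze_zero (fun _ => Metric.infDist_nonneg) (fun t => ?_) hbound
  have hmem : (-x₃ t / k, 0, x₃ t) ∈ {p : ℝ × ℝ × ℝ | k * p.1 = -p.2.2 ∧ p.2.1 = 0} :=
    ⟨mul_div_cancel₀ _ hk.ne', rfl⟩
  refine (Metric.infDist_le_dist_of_mem hmem).trans ?_
  have e : x₁ t - -x₃ t / k = (k * x₁ t + x₃ t) / k := by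
    field_simp
    ring
  simp only [Prod.dist_eq, Real.dist_eq, e, abs_div, abs_of_pos hk, sub_self, abs_zero, sub_zero]
  exact max_le (le_add_of_nonneg_right (abs_nonneg _))
    (max_le (le_add_of_nonneg_left (by positivity)) (by positivity))
end
end
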